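/- arXiv:math/9811131 — 3 statements merged into one kernel-verified Lean document; each statement's English description precedes it below -/
import Mathlib

section
/- Suppose n = 3 and d = 3. Then for all integers i with 1 ≤ i ≤ 6 and all integers q ≥ 2, the Veronese–Koszul complex at (i,q) is exact. (Equivalently, the cubic Veronese embedding φ_{O(3)} : P^3 ↪ P^{19} satisfies property N_6.) -/
open TensorProduct

noncomputable section

variable (K : Type*) [Field K]

/-- `S K n e` is the space of homogeneous polynomials of degree `e`
in the `n+1` variables `x_0, …, x_n`. -/
abbrev S (n e : ℕ) : Submodule K (MvPolynomial (Fin (n + 1)) K) :=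
  MvPolynomial.homogeneousSubmodule (Fin (n + 1)) K e

/-- The product of a homogeneous polynomial of degree `d` with one of degree `b`,
viewed as an element of degree `b + d`. -/
def mulSW {n d b : ℕ} (s : S K n d) (w : S K n b) : S K n (b + d) :=
  ⟨(s : MvPolynomial (Fin (n + 1)) K) * (w : MvPolynomial (Fin (n + 1)) K), by
    rw [MvPolynomial.mem_homogeneousSubmodule, Nat.add_comm b d]
    exact ((MvPolynomial.mem_homogeneousSubmodule _ _).1 s.2).mul
      ((MvPolynomial.mem_homogeneousSubmodule _ _).1 w.2)⟩

/-- Identification of spaces of homogeneous polynomials of equal degrees. -/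
def scast {n e₁ e₂ : ℕ} (h : e₁ = e₂) : S K n e₁ ≃ₗ[K] S K n e₂ :=
  LinearEquiv.ofEq _ _ (by rw [h])

/-- The increasing injection `Fin (a-1) → Fin a` omitting `j`. -/
def skipAt {a : ℕ} (j : Fin a) (i : Fin (a - 1)) : Fin a :=
  if (i : ℕ) < (j : ℕ) then ⟨i, by have := i.isLt; omega⟩
  else ⟨(i : ℕ) + 1, by have := i.isLt; omega⟩

/-- The wedge `v 0 ∧ ⋯ ∧ v (a-1)` as an element of the `a`-th exterior power. -/
def wedge {M : Type*} [AddCommGroup M] [Module K M] (a : ℕ) (v : Fin a → M) :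
    ⋀[K]^a M :=
  ⟨ExteriorAlgebra.ιMulti K a v, ExteriorAlgebra.ιMulti_range K a ⟨v, rfl⟩⟩

/-- `IsKoszulMap K n d a b δ` says that `δ : ⋀^a S_d ⊗ S_b → ⋀^{a-1} S_d ⊗ S_{b+d}` is
the Koszul map, i.e. it satisfies
`δ((s_1 ∧ ⋯ ∧ s_a) ⊗ w) = Σ_j (−1)^{j−1} (s_1 ∧ ⋯ ∧ ŝ_j ∧ ⋯ ∧ s_a) ⊗ (s_j·w)`. -/
def IsKoszulMap (n d a b : ℕ)
    (δ : ((⋀[K]^a (S K n d)) ⊗[K] (S K n b)) →ₗ[K]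
         ((⋀[K]^(a - 1) (S K n d)) ⊗[K] (S K n (b + d)))) : Prop :=
  ∀ (s : Fin a → S K n d) (w : S K n b),
    δ (wedge K a s ⊗ₜ[K] w) =
      ∑ j : Fin a, ((-1 : K) ^ (j : ℕ)) •
        ((wedge K (a - 1) fun i => s (skipAt j i)) ⊗ₜ[K] mulSW K (s j) w)

/-- Exactness of the Veronese–Koszul complex at `(i, q)`:
`ker δ_{i,qd} = im δ_{i+1,(q−1)d}` inside `⋀^i S_d ⊗ S_{qd}`. -/
def VKExact (n d i q : ℕ) : Prop :=
  ∀ (h : (q - 1) * d + d = q * d)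
    (δ₁ : ((⋀[K]^i (S K n d)) ⊗[K] (S K n (q * d))) →ₗ[K]
          ((⋀[K]^(i - 1) (S K n d)) ⊗[K] (S K n (q * d + d))))
    (δ₂ : ((⋀[K]^(i + 1) (S K n d)) ⊗[K] (S K n ((q - 1) * d))) →ₗ[K]
          ((⋀[K]^i (S K n d)) ⊗[K] (S K n ((q - 1) * d + d)))),
    IsKoszulMap K n d i (q * d) δ₁ → IsKoszulMap K n d (i + 1) ((q - 1) * d) δ₂ →
    LinearMap.ker δ₁ =
      LinearMap.range
        ((TensorProduct.congr (LinearEquiv.refl K (⋀[K]^i (S K n d)))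
            (scast K h)).toLinearMap ∘ₗ δ₂)

end

namespace VK

/-! ## Combinatorial data -/

/-- exponents of the twenty cubic monomials, the four cubes first -/
def mon : Fin 20 → Fin 4 → ℕ :=
  ![![3, 0, 0, 0], ![0, 3, 0, 0], ![0, 0, 3, 0], ![0, 0, 0, 3], ![0, 0, 1, 2], ![0, 0, 2, 1], ![0, 1, 0, 2], ![0, 1, 1, 1], ![0, 1, 2, 0], ![0, 2, 0, 1], ![0, 2, 1, 0], ![1, 0, 0, 2], ![1, 0, 1, 1], ![1, 0, 2, 0], ![1, 1, 0, 1], ![1, 1, 1, 0], ![1, 2, 0, 0], ![2, 0, 0, 1], ![2, 0, 1, 0], ![2, 1, 0, 0]]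

/-- exponents of the ten monomials of degree 6 with exponents at most 2 -/
def mon6 : Fin 10 → Fin 4 → ℕ :=
  ![![0, 2, 2, 2], ![1, 1, 2, 2], ![1, 2, 1, 2], ![1, 2, 2, 1], ![2, 0, 2, 2], ![2, 1, 1, 2], ![2, 1, 2, 1], ![2, 2, 0, 2], ![2, 2, 1, 1], ![2, 2, 2, 0]]

/-- for every non-cube `m` the list of `(j, t)` with `mon j + mon m = mon6 t` (shifted by 4) -/
def rows : List (List (ℕ × ℕ)) :=
  [
   [(6, 0), (11, 1), (12, 2), (14, 4), (15, 5)],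
   [(5, 0), (10, 1), (12, 3), (13, 4), (15, 6)],
   [(4, 0), (9, 1), (11, 2), (14, 5), (15, 7)],
   [(3, 0), (8, 1), (10, 2), (11, 3), (13, 5), (14, 6), (15, 8)],
   [(2, 0), (7, 1), (10, 3), (13, 6), (15, 9)],
   [(1, 0), (8, 2), (9, 3), (13, 7), (14, 8)],
   [(0, 0), (7, 2), (8, 3), (13, 8), (14, 9)],
   [(4, 1), (6, 2), (9, 4), (11, 5), (12, 7)],
   [(3, 1), (5, 2), (6, 3), (8, 4), (10, 5), (11, 6), (12, 8)],
   [(2, 1), (5, 3), (7, 4), (10, 6), (12, 9)],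
   [(1, 1), (3, 2), (4, 3), (8, 5), (9, 6), (10, 7), (11, 8)],
   [(0, 1), (2, 2), (3, 3), (7, 5), (8, 6), (10, 8), (11, 9)],
   [(0, 2), (1, 3), (7, 7), (8, 8), (9, 9)],
   [(1, 4), (3, 5), (4, 6), (5, 7), (6, 8)],
   [(0, 4), (2, 5), (3, 6), (5, 8), (6, 9)],
   [(0, 5), (1, 6), (2, 7), (3, 8), (4, 9)]]

/-! ## The bit-parallel propagation programme -/

/-- bit set of all `F < 2^b` which do not contain the bit `j` -/
def nmask : ℕ → ℕ → ℕ
  | 0, _ => 1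
  | b + 1, j => if b = j then nmask b j else nmask b j ||| (nmask b j <<< 2 ^ b)

/-- bit set of all `F < 2^b` with at most `k` bits -/
def lmask : ℕ → ℕ → ℕ
  | 0, _ => 1
  | b + 1, 0 => lmask b 0
  | b + 1, k + 1 => lmask b (k + 1) ||| (lmask b k <<< 2 ^ b)

/-- evaluate `n` before continuing -/
def force {α : Type} (n : ℕ) (k : ℕ → α) : α :=
  bif Nat.beq n 0 then k n else k n

theorem force_eq {α : Type} (n : ℕ) (k : ℕ → α) : force n k = k n := by
  unfold force; cases Nat.beq n 0 <;> rfl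

/-- relations `G` which contain `j` with alive term `(G - j, t)` -/
def shiftT (al : List ℕ) (p : ℕ × ℕ) : ℕ :=
  ((al.getD p.2 0) &&& nmask 16 p.1) <<< 2 ^ p.1

/-- the sets of relations with at least one / at least two alive terms -/
def acc (al : List ℕ) : List (ℕ × ℕ) → ℕ × ℕ
  | [] => (0, 0)
  | p :: r => (((acc al r).1 ||| shiftT al p),
      ((acc al r).2 ||| ((acc al r).1 &&& shiftT al p)))

/-- an element stays alive if it does not occur or two terms of the relation are alive -/
def survive (w : ℕ) (j x : ℕ) : ℕ :=
  (x &&& (nmask 16 j <<< 2 ^ j)) ||| ((x &&& nmask 16 j) &&& (w >>> 2 ^ j))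

def kill (w : ℕ) : List (ℕ × ℕ) → List ℕ → List ℕ
  | [], al => al
  | p :: r, al => force (survive w p.1 (al.getD p.2 0)) fun x => kill w r (al.set p.2 x)

def sweep : List (List (ℕ × ℕ)) → List ℕ → List ℕ
  | [], al => al
  | r :: rs, al => force (acc al r).2 fun w => sweep rs (kill w r al)

def iter : ℕ → List ℕ → List ℕ
  | 0, al => al
  | n + 1, al => iter n (sweep rows al)

/-- everything alive except for the two special elements -/
def start : List ℕ :=
  let a := 2 ^ 65536 - 1
  [a, a, a, a, a, a, a ^^^ (1 <<< 41059), a, a ^^^ (1 <<< 24675), a]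

def finalCheck : Bool := (iter 10 start).all fun x => Nat.beq (x &&& lmask 16 6) 0
set_option exponentiation.threshold 100000 in
theorem finalCheck_true : finalCheck = true := by decide +kernel
/-! ## Soundness of the programme -/

/-- the Koszul sign of `j` relative to `F` -/
def sgn (j : Fin 20) (F : Finset (Fin 20)) : ℤ := (-1) ^ (F.filter (fun k => k < j)).card

/-- encoding of sets of non-cubes -/
def enc (F : Finset (Fin 20)) : ℕ := ∑ j ∈ F, 2 ^ ((j : ℕ) - 4)

theorem enc_insert {j : Fin 20} {F : Finset (Fin 20)} (h : j ∉ F) :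
    enc (insert j F) = 2 ^ ((j : ℕ) - 4) + enc F := by
  unfold enc; rw [Finset.sum_insert h]

theorem enc_erase {j : Fin 20} {F : Finset (Fin 20)} (h : j ∈ F) :
    2 ^ ((j : ℕ) - 4) + enc (F.erase j) = enc F := by
  unfold enc; rw [Finset.add_sum_erase _ (fun j : Fin 20 => 2 ^ ((j : ℕ) - 4)) h]

theorem enc_lt (b : ℕ) (hb : b ≤ 16) : ∀ F : Finset (Fin 20),
    (∀ k ∈ F, 4 ≤ (k : ℕ) ∧ (k : ℕ) < b + 4) → enc F < 2 ^ b := by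
  induction b with
  | zero =>
    intro F hF
    have : F = ∅ := by
      apply Finset.eq_empty_of_forall_notMem
      intro k hk; have := hF k hk; omega
    subst this; simp [enc]
  | succ b ih =>
    intro F hF
    by_cases hk : (⟨b + 4, by omega⟩ : Fin 20) ∈ F
    · have h1 := ih (by omega) (F.erase ⟨b + 4, by omega⟩) (by
        intro k hk'
        have h2 := hF k (Finset.mem_of_mem_erase hk')
        have h3 := Finset.ne_of_mem_erase hk'
        have : (k : ℕ) ≠ b + 4 := fun h => h3 (Fin.ext h)
        omega)
      have h4 := enc_erase hk
      simp only [Nat.add_sub_cancel] at h4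
      rw [pow_succ]; omega
    · have h1 := ih (by omega) F (by
        intro k hk'
        have h2 := hF k hk'
        have : (k : ℕ) ≠ b + 4 := fun h => hk (by
          have : k = ⟨b + 4, by omega⟩ := Fin.ext h
          rwa [← this])
        omega)
      rw [pow_succ]; omega

theorem nmask_spec (j : Fin 20) (hj : 4 ≤ (j : ℕ)) (b : ℕ) (hb : b ≤ 16) : ∀ F : Finset (Fin 20),
    (∀ k ∈ F, 4 ≤ (k : ℕ) ∧ (k : ℕ) < b + 4) → j ∉ F →
    (nmask b ((j : ℕ) - 4)).testBit (enc F) = true := by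
  induction b with
  | zero =>
    intro F hF _
    have : F = ∅ := by
      apply Finset.eq_empty_of_forall_notMem
      intro k hk; have := hF k hk; omega
    subst this; simp [enc, nmask]
  | succ b ih =>
    intro F hF hjF
    by_cases hk : (⟨b + 4, by omega⟩ : Fin 20) ∈ F
    · have h1 := ih (by omega) (F.erase ⟨b + 4, by omega⟩) (by
        intro k hk'
        have h2 := hF k (Finset.mem_of_mem_erase hk')
        have h3 := Finset.ne_of_mem_erase hk'
        have : (k : ℕ) ≠ b + 4 := fun h => h3 (Fin.ext h)
        omega) (fun h => hjF (Finset.mem_of_mem_erase h))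
      have h4 := enc_erase hk
      simp only [Nat.add_sub_cancel] at h4
      have h5 : b ≠ (j : ℕ) - 4 := by
        intro h
        apply hjF
        have : j = ⟨b + 4, by omega⟩ := Fin.ext (by simp; omega)
        rwa [this]
      rw [nmask, if_neg h5, Nat.testBit_or, Nat.testBit_shiftLeft, ← h4]
      simp [h1]
    · have h1 := ih (by omega) F (by
        intro k hk'
        have h2 := hF k hk'
        have : (k : ℕ) ≠ b + 4 := fun h => hk (by
          have : k = ⟨b + 4, by omega⟩ := Fin.ext h
          rwa [← this])
        omega) hjF
      rw [nmask]
      split_ifs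
      · exact h1
      · rw [Nat.testBit_or, h1]; rfl

theorem lmask_spec (b : ℕ) (hb : b ≤ 16) : ∀ (n : ℕ) (F : Finset (Fin 20)),
    (∀ k ∈ F, 4 ≤ (k : ℕ) ∧ (k : ℕ) < b + 4) → F.card ≤ n →
    (lmask b n).testBit (enc F) = true := by
  induction b with
  | zero =>
    intro n F hF _
    have : F = ∅ := by
      apply Finset.eq_empty_of_forall_notMem
      intro k hk; have := hF k hk; omega
    subst this; simp [enc, lmask]
  | succ b ih =>
    intro n F hF hn
    by_cases hk : (⟨b + 4, by omega⟩ : Fin 20) ∈ F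
    · have hc := Finset.card_erase_add_one hk
      obtain ⟨n, rfl⟩ : ∃ n', n = n' + 1 := ⟨n - 1, by omega⟩
      have h1 := ih (by omega) n (F.erase ⟨b + 4, by omega⟩) (by
        intro k hk'
        have h2 := hF k (Finset.mem_of_mem_erase hk')
        have h3 := Finset.ne_of_mem_erase hk'
        have : (k : ℕ) ≠ b + 4 := fun h => h3 (Fin.ext h)
        omega) (by omega)
      have h4 := enc_erase hk
      simp only [Nat.add_sub_cancel] at h4
      rw [lmask, Nat.testBit_or, Nat.testBit_shiftLeft, ← h4]
      simp [h1]
    · have h1 := ih (by omega) n F (by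
        intro k hk'
        have h2 := hF k hk'
        have : (k : ℕ) ≠ b + 4 := fun h => hk (by
          have : k = ⟨b + 4, by omega⟩ := Fin.ext h
          rwa [← this])
        omega) hn
      cases n with
      | zero => rw [lmask]; exact h1
      | succ n => rw [lmask, Nat.testBit_or, h1]; rfl

/-- set of non-cubes -/
def Big (F : Finset (Fin 20)) : Prop := ∀ k ∈ F, 4 ≤ (k : ℕ)

theorem Big.bd {F : Finset (Fin 20)} (h : Big F) : ∀ k ∈ F, 4 ≤ (k : ℕ) ∧ (k : ℕ) < 16 + 4 :=
  fun k hk => ⟨h k hk, k.2⟩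

theorem Big.erase {F : Finset (Fin 20)} (h : Big F) (j : Fin 20) : Big (F.erase j) :=
  fun k hk => h k (Finset.mem_of_mem_erase hk)

section soundness

variable {Q : Type*} [AddCommGroup Q] (e : Finset (Fin 20) → Fin 10 → Q)

/-- the relations -/
def Rel : Prop := ∀ G, Big G → ∀ m : Fin 20, 4 ≤ (m : ℕ) →
  ∑ j ∈ G, ∑ t : Fin 10,
    (if mon j + mon m = mon6 t then sgn j G • e (G.erase j) t else 0) = 0

/-- the invariant -/
def Inv (al : List ℕ) : Prop := ∀ F, Big F → ∀ t : Fin 10, e F t ≠ 0 →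
  (al.getD t 0).testBit (enc F) = true

theorem rows_spec : ∀ m j : Fin 20, ∀ t : Fin 10, 4 ≤ (m : ℕ) → 4 ≤ (j : ℕ) →
    mon j + mon m = mon6 t → ((j : ℕ) - 4, (t : ℕ)) ∈ rows.getD ((m : ℕ) - 4) [] := by
  decide +kernel

theorem acc_fst (al : List ℕ) (x : ℕ) (r : List (ℕ × ℕ)) (p : ℕ × ℕ) (hp : p ∈ r)
    (h : (shiftT al p).testBit x = true) : (acc al r).1.testBit x = true := by
  induction r with
  | nil => simp at hp
  | cons a r ih =>
    rw [acc]
    simp only [Nat.testBit_or, Bool.or_eq_true]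
    rcases List.mem_cons.1 hp with rfl | hp
    · exact Or.inr h
    · exact Or.inl (ih hp)

theorem acc_snd (al : List ℕ) (x : ℕ) (r : List (ℕ × ℕ)) (h : (acc al r).2.testBit x = false)
    (p p' : ℕ × ℕ) (hp : p ∈ r) (hp' : p' ∈ r)
    (hT : (shiftT al p).testBit x = true) (hT' : (shiftT al p').testBit x = true) : p = p' := by
  induction r with
  | nil => simp at hp
  | cons a r ih =>
    rw [acc] at h
    simp only [Nat.testBit_or, Nat.testBit_and, Bool.or_eq_false_iff] at h
    rcases List.mem_cons.1 hp with h1 | h1 <;> rcases List.mem_cons.1 hp' with h2 | h2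
    · rw [h1, h2]
    · have := acc_fst al x r p' h2 hT'
      rw [this, ← h1, hT] at h; simp at h
    · have := acc_fst al x r p h1 hT
      rw [this, ← h2, hT'] at h; simp at h
    · exact ih h.1 h1 h2

variable {e}

theorem shiftT_spec {al : List ℕ} (hI : Inv e al) {G : Finset (Fin 20)} (hG : Big G)
    {j : Fin 20} (hj : j ∈ G) {t : Fin 10} (h : e (G.erase j) t ≠ 0) :
    (shiftT al ((j : ℕ) - 4, (t : ℕ))).testBit (enc G) = true := by
  have h1 := hI _ (hG.erase j) t h
  have h2 := nmask_spec j (hG j hj) 16 le_rfl _ (hG.erase j).bd (Finset.notMem_erase j G)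
  unfold shiftT
  rw [Nat.testBit_shiftLeft, ← enc_erase hj]
  simp [h1, h2, -List.getD_eq_getElem?_getD]

theorem all_zero (hR : Rel e) {al : List ℕ} (hI : Inv e al) {m : Fin 20} (hm : 4 ≤ (m : ℕ))
    {r : List (ℕ × ℕ)} (hr : r = rows.getD ((m : ℕ) - 4) [])
    {G : Finset (Fin 20)} (hG : Big G) (hw : (acc al r).2.testBit (enc G) = false)
    {j : Fin 20} (hj : j ∈ G) {t : Fin 10} (hjt : mon j + mon m = mon6 t) :
    e (G.erase j) t = 0 := by
  by_contra hne
  have hT := shiftT_spec hI hG hj hne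
  have hmem := rows_spec m j t hm (hG j hj) hjt
  rw [← hr] at hmem
  have key : ∀ j' ∈ G, ∀ t' : Fin 10, mon j' + mon m = mon6 t' → e (G.erase j') t' ≠ 0 →
      j' = j ∧ t' = t := by
    intro j' hj' t' h' hne'
    have hmem' := rows_spec m j' t' hm (hG j' hj') h'
    rw [← hr] at hmem'
    have := acc_snd al _ r hw _ _ hmem' hmem (shiftT_spec hI hG hj' hne') hT
    simp only [Prod.mk.injEq] at this
    have h4 := hG j hj
    have h5 := hG j' hj'
    exact ⟨Fin.ext (by omega), Fin.ext this.2⟩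
  have h := hR G hG m hm
  rw [Finset.sum_eq_single j, Finset.sum_eq_single t, if_pos hjt] at h
  · apply hne
    unfold sgn at h
    rcases neg_one_pow_eq_or ℤ (G.filter (fun k => k < j)).card with h' | h' <;> simpa [h'] using h
  · intro t' _ ht'
    split_ifs with h'
    · by_cases h0 : e (G.erase j) t' = 0
      · rw [h0, smul_zero]
      · exact absurd (key j hj t' h' h0).2 ht'
    · rfl
  · simp
  · intro j' hj' hjj
    apply Finset.sum_eq_zero
    intro t' _
    split_ifs with h'
    · by_cases h0 : e (G.erase j') t' = 0
      · rw [h0, smul_zero]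
      · exact absurd (key j' hj' t' h' h0).1 hjj
    · rfl
  · exact fun h => absurd hj h

/-- what a row has to satisfy so that killing is allowed -/
def Good (e : Finset (Fin 20) → Fin 10 → Q) (w : ℕ) (p : ℕ × ℕ) : Prop :=
  ∀ (j : Fin 20) (t : Fin 10), 4 ≤ (j : ℕ) → p = ((j : ℕ) - 4, (t : ℕ)) →
    ∀ G, Big G → j ∈ G → w.testBit (enc G) = false → e (G.erase j) t = 0

theorem getD_set_ne (al : List ℕ) (a b x : ℕ) (h : a ≠ b) : (al.set a x).getD b 0 = al.getD b 0 := by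
  simp [List.getD_eq_getElem?_getD, List.getElem?_set_ne h]

theorem getD_set_eq (al : List ℕ) (a x : ℕ) (h : a < al.length) : (al.set a x).getD a 0 = x := by
  simp [List.getD_eq_getElem?_getD, h]

theorem kill_inv (w : ℕ) (r : List (ℕ × ℕ))
    (hr : ∀ p ∈ r, p.1 < 16 ∧ p.2 < 10 ∧ Good e w p) :
    ∀ al : List ℕ, al.length = 10 → Inv e al → Inv e (kill w r al) ∧ (kill w r al).length = 10 := by
  induction r with
  | nil => intro al h1 h2; exact ⟨h2, h1⟩
  | cons p r ih =>
    intro al h1 h2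
    rw [kill, force_eq]
    apply ih (fun q hq => hr q (List.mem_cons_of_mem _ hq))
    · simpa using h1
    · intro F hF t hne
      have h3 := h2 F hF t hne
      obtain ⟨hp1, hp2, hp3⟩ := hr p List.mem_cons_self
      by_cases ht : p.2 = t
      · rw [ht, getD_set_eq _ _ _ (by omega)]
        let j : Fin 20 := ⟨p.1 + 4, by omega⟩
        have hj4 : 4 ≤ (j : ℕ) := by simp [j]
        have hjp : (j : ℕ) - 4 = p.1 := by simp [j]
        unfold survive
        by_cases hjF : j ∈ F
        · have h4 := nmask_spec j hj4 16 le_rfl _ (hF.erase j).bd (Finset.notMem_erase j F)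
          rw [Nat.testBit_or, Nat.testBit_and, Nat.testBit_shiftLeft, h3]
          rw [← enc_erase hjF, hjp]
          rw [hjp] at h4
          simp [h4]
        · have h4 := nmask_spec j hj4 16 le_rfl _ hF.bd hjF
          rw [hjp] at h4
          have h5 : w.testBit (2 ^ p.1 + enc F) = true := by
            by_contra hw
            rw [Bool.not_eq_true] at hw
            apply hne
            have := hp3 j t hj4 (Prod.ext hjp.symm ht) (insert j F)
              (by intro k hk; rcases Finset.mem_insert.1 hk with rfl | hk
                  · exact hj4
                  · exact hF k hk) (Finset.mem_insert_self _ _)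
              (by rw [enc_insert hjF, hjp]; exact hw)
            rwa [Finset.erase_insert hjF] at this
          rw [Nat.testBit_or, Nat.testBit_and, Nat.testBit_and, Nat.testBit_and, h3, h4,
            Nat.testBit_shiftRight, h5]
          simp
      · rw [getD_set_ne _ _ _ _ ht]; exact h3

theorem rows_bd : ∀ r ∈ rows, ∀ p ∈ r, p.1 < 16 ∧ p.2 < 10 := by decide +kernel

theorem rows_spec' : ∀ (m : Fin 16), ∀ p ∈ rows.getD (m : ℕ) [], ∀ j : Fin 20, ∀ t : Fin 10,
    4 ≤ (j : ℕ) → p = ((j : ℕ) - 4, (t : ℕ)) → mon j + mon (Fin.natAdd 4 m) = mon6 t := by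
  decide +kernel

theorem rows_mem : ∀ r ∈ rows, ∃ m : Fin 16, r = rows.getD (m : ℕ) [] := by decide +kernel

theorem sweep_inv (hR : Rel e) (rs : List (List (ℕ × ℕ))) (hrs : ∀ r ∈ rs, r ∈ rows) :
    ∀ al : List ℕ, al.length = 10 → Inv e al → Inv e (sweep rs al) ∧ (sweep rs al).length = 10 := by
  induction rs with
  | nil => intro al h1 h2; exact ⟨h2, h1⟩
  | cons r rs ih =>
    intro al h1 h2
    rw [sweep, force_eq]
    have hr := hrs r List.mem_cons_self
    have := kill_inv (e := e) (acc al r).2 r (by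
      intro p hp
      refine ⟨(rows_bd r hr p hp).1, (rows_bd r hr p hp).2, ?_⟩
      obtain ⟨m, hm⟩ := rows_mem r hr
      intro j t hj hpj G hG hjG hw
      refine all_zero hR h2 (m := Fin.natAdd 4 m) (by simp) (r := r) (by simpa using hm)
        hG hw hjG ?_
      exact rows_spec' m p (hm ▸ hp) j t hj hpj) al h1 h2
    exact ih (fun r' h' => hrs r' (List.mem_cons_of_mem _ h')) _ this.2 this.1

theorem iter_inv (hR : Rel e) (n : ℕ) : ∀ al : List ℕ, al.length = 10 → Inv e al →
    Inv e (iter n al) := by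
  induction n with
  | zero => intro al _ h; exact h
  | succ n ih =>
    intro al h1 h2
    rw [iter]
    have := sweep_inv hR rows (fun _ h => h) al h1 h2
    exact ih _ this.2 this.1

/-- a relation with two terms -/
theorem two_term (hR : Rel e) (G : Finset (Fin 20)) (m j₁ : Fin 20) (t₁ : Fin 10) (j₂ : Fin 20)
    (t₂ : Fin 10) (s₁ s₂ : ℤ) (F₁ F₂ : Finset (Fin 20))
    (h : (∀ k ∈ G, 4 ≤ (k : ℕ)) ∧ 4 ≤ (m : ℕ) ∧ j₁ ∈ G ∧ j₂ ∈ G ∧ j₁ ≠ j₂ ∧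
      (∀ j ∈ G, ∀ t : Fin 10, mon j + mon m = mon6 t ↔ (j = j₁ ∧ t = t₁) ∨ (j = j₂ ∧ t = t₂)) ∧
      sgn j₁ G = s₁ ∧ sgn j₂ G = s₂ ∧ G.erase j₁ = F₁ ∧ G.erase j₂ = F₂) :
    s₁ • e F₁ t₁ + s₂ • e F₂ t₂ = 0 := by
  obtain ⟨hG, hm, hj1, hj2, hne, hall, rfl, rfl, rfl, rfl⟩ := h
  have h := hR G hG m hm
  rw [← Finset.add_sum_erase _ _ hj1, ← Finset.add_sum_erase _ _
    (Finset.mem_erase.2 ⟨hne.symm, hj2⟩), Finset.sum_eq_zero (s := (G.erase j₁).erase j₂),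
    Finset.sum_eq_single t₁, Finset.sum_eq_single t₂, if_pos, if_pos, add_zero] at h
  · exact h
  · exact (hall j₂ hj2 t₂).2 (Or.inr ⟨rfl, rfl⟩)
  · exact (hall j₁ hj1 t₁).2 (Or.inl ⟨rfl, rfl⟩)
  · intro t _ ht
    rw [if_neg]
    rw [hall j₂ hj2 t]
    rintro (h | h)
    · exact hne h.1.symm
    · exact ht h.2
  · simp
  · intro t _ ht
    rw [if_neg]
    rw [hall j₁ hj1 t]
    rintro (h | h)
    · exact ht h.2
    · exact hne h.1
  · simp
  · intro j hj
    apply Finset.sum_eq_zero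
    intro t _
    simp only [Finset.mem_erase] at hj
    rw [if_neg]
    rw [hall j hj.2.2 t]
    rintro (h | h)
    · exact hj.2.1 h.1
    · exact hj.1 h.1

theorem special₁ [IsAddTorsionFree Q] (hR : Rel e) : e {4, 5, 9, 10, 17, 18} 8 = 0 := by
  have h1 := two_term hR {4, 5, 9, 10, 14, 17, 18} 15 4 1 14 8 (1) (1) {5, 9, 10, 14, 17, 18} {4, 5, 9, 10, 17, 18} (by decide +kernel)
  have h2 := two_term hR {5, 8, 9, 10, 14, 17, 18} 11 8 1 10 2 (-1) (-1) {5, 9, 10, 14, 17, 18} {5, 8, 9, 14, 17, 18} (by decide +kernel)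
  have h3 := two_term hR {5, 6, 8, 9, 14, 17, 18} 15 6 2 14 8 (-1) (1) {5, 8, 9, 14, 17, 18} {5, 6, 8, 9, 17, 18} (by decide +kernel)
  have h4 := two_term hR {5, 6, 8, 9, 16, 17, 18} 12 9 2 16 8 (-1) (1) {5, 6, 8, 16, 17, 18} {5, 6, 8, 9, 17, 18} (by decide +kernel)
  have h5 := two_term hR {4, 5, 9, 10, 15, 17, 18} 14 5 1 15 8 (-1) (1) {4, 9, 10, 15, 17, 18} {4, 5, 9, 10, 17, 18} (by decide +kernel)
  have h6 := two_term hR {4, 6, 9, 10, 15, 17, 18} 13 6 1 9 3 (-1) (1) {4, 9, 10, 15, 17, 18} {4, 6, 10, 15, 17, 18} (by decide +kernel)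
  have h7 := two_term hR {4, 6, 8, 10, 15, 17, 18} 14 8 3 15 8 (1) (1) {4, 6, 10, 15, 17, 18} {4, 6, 8, 10, 17, 18} (by decide +kernel)
  have h8 := two_term hR {4, 6, 8, 10, 16, 17, 18} 12 10 3 16 8 (-1) (1) {4, 6, 8, 16, 17, 18} {4, 6, 8, 10, 17, 18} (by decide +kernel)
  have h9 := two_term hR {4, 5, 6, 8, 16, 17, 18} 16 4 2 5 3 (1) (-1) {5, 6, 8, 16, 17, 18} {4, 6, 8, 16, 17, 18} (by decide +kernel)
  have h : (2 : ℤ) • e {4, 5, 9, 10, 17, 18} 8 = 0 := by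
    linear_combination (norm := module) h1 + h2 - h3 + h4 + h5 - h6 + h7 - h8 + h9
  simpa using h

theorem special₂ [IsAddTorsionFree Q] (hR : Rel e) : e {4, 5, 9, 10, 17, 19} 6 = 0 := by
  have h1 := two_term hR {4, 5, 9, 10, 12, 17, 19} 15 4 1 12 6 (1) (1) {5, 9, 10, 12, 17, 19} {4, 5, 9, 10, 17, 19} (by decide +kernel)
  have h2 := two_term hR {5, 8, 9, 10, 12, 17, 19} 11 8 1 10 2 (-1) (-1) {5, 9, 10, 12, 17, 19} {5, 8, 9, 12, 17, 19} (by decide +kernel)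
  have h3 := two_term hR {5, 6, 8, 9, 12, 17, 19} 15 6 2 12 6 (-1) (1) {5, 8, 9, 12, 17, 19} {5, 6, 8, 9, 17, 19} (by decide +kernel)
  have h4 := two_term hR {5, 6, 8, 9, 15, 17, 19} 12 9 2 15 6 (-1) (1) {5, 6, 8, 15, 17, 19} {5, 6, 8, 9, 17, 19} (by decide +kernel)
  have h5 := two_term hR {4, 5, 9, 10, 13, 17, 19} 14 5 1 13 6 (-1) (1) {4, 9, 10, 13, 17, 19} {4, 5, 9, 10, 17, 19} (by decide +kernel)
  have h6 := two_term hR {4, 6, 9, 10, 13, 17, 19} 13 6 1 9 3 (-1) (1) {4, 9, 10, 13, 17, 19} {4, 6, 10, 13, 17, 19} (by decide +kernel)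
  have h7 := two_term hR {4, 6, 8, 10, 13, 17, 19} 14 8 3 13 6 (1) (1) {4, 6, 10, 13, 17, 19} {4, 6, 8, 10, 17, 19} (by decide +kernel)
  have h8 := two_term hR {4, 6, 8, 10, 15, 17, 19} 12 10 3 15 6 (-1) (1) {4, 6, 8, 15, 17, 19} {4, 6, 8, 10, 17, 19} (by decide +kernel)
  have h9 := two_term hR {4, 5, 6, 8, 15, 17, 19} 16 4 2 5 3 (1) (-1) {5, 6, 8, 15, 17, 19} {4, 6, 8, 15, 17, 19} (by decide +kernel)
  have h : (2 : ℤ) • e {4, 5, 9, 10, 17, 19} 6 = 0 := by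
    linear_combination (norm := module) h1 + h2 - h3 + h4 + h5 - h6 + h7 - h8 + h9
  simpa using h

theorem start_len : start.length = 10 := rfl

theorem testBit_full {x : ℕ} (h : x < 65536) : (2 ^ 65536 - 1).testBit x = true := by
  rw [Nat.testBit_two_pow_sub_one]; simpa using h

theorem enc_special₁ : enc {4, 5, 9, 10, 17, 18} = 24675 := by decide +kernel

theorem enc_special₂ : enc {4, 5, 9, 10, 17, 19} = 41059 := by decide +kernel

end soundness

theorem enc_inj {F G : Finset (Fin 20)} (hF : Big F) (hG : Big G) (h : enc F = enc G) : F = G := by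
  have key : ∀ F : Finset (Fin 20), Big F →
      enc F = ∑ i ∈ F.image (fun k : Fin 20 => (k : ℕ) - 4), 2 ^ i := by
    intro F hF
    rw [Finset.sum_image]
    · rfl
    · intro a ha b hb hab
      have h1 := hF a ha
      have h2 := hF b hb
      exact Fin.ext (by simp only at hab; omega)
  rw [key F hF, key G hG] at h
  have h' := Finset.geomSum_injective (n := 2) le_rfl h
  have sub : ∀ F G : Finset (Fin 20), Big F → Big G →
      F.image (fun k : Fin 20 => (k : ℕ) - 4) = G.image (fun k : Fin 20 => (k : ℕ) - 4) →
      F ⊆ G := by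
    intro F G hF hG h a ha
    have : (a : ℕ) - 4 ∈ G.image (fun k : Fin 20 => (k : ℕ) - 4) :=
      h ▸ Finset.mem_image_of_mem _ ha
    obtain ⟨b, hb, hab⟩ := Finset.mem_image.1 this
    have h1 := hF a ha
    have h2 := hG b hb
    have : b = a := Fin.ext (by omega)
    exact this ▸ hb
  exact Finset.Subset.antisymm (sub F G hF hG h') (sub G F hG hF h'.symm)

theorem start_inv {Q : Type*} [AddCommGroup Q] [IsAddTorsionFree Q]
    {e : Finset (Fin 20) → Fin 10 → Q} (hR : Rel e) : Inv e start := by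
  intro F hF t hne
  have hlt : enc F < 65536 := enc_lt 16 le_rfl F hF.bd
  have hfull := testBit_full hlt
  have h1 : t = 8 → enc F ≠ 24675 := by
    rintro rfl h
    apply hne
    rw [← enc_special₁] at h
    rw [enc_inj hF (by unfold Big; decide) h]
    exact special₁ hR
  have h2 : t = 6 → enc F ≠ 41059 := by
    rintro rfl h
    apply hne
    rw [← enc_special₂] at h
    rw [enc_inj hF (by unfold Big; decide) h]
    exact special₂ hR
  have hx : ∀ n, enc F ≠ n → ((2 ^ 65536 - 1) ^^^ (1 <<< n)).testBit (enc F) = true := by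
    intro n hn
    rw [Nat.testBit_xor, hfull, Nat.testBit_shiftLeft]
    by_cases h : n ≤ enc F
    · have : (Nat.testBit 1 (enc F - n)) = false := by
        rw [← Bool.not_eq_true, Nat.testBit_one_eq_true_iff_self_eq_zero]; omega
      simp [this]
    · simp [h]
  unfold start
  generalize hA : 2 ^ 65536 - 1 = A at *
  fin_cases t
  all_goals first
    | exact hfull
    | exact hx _ (h1 rfl)
    | exact hx _ (h2 rfl)

theorem core {Q : Type*} [AddCommGroup Q] [IsAddTorsionFree Q]
    {e : Finset (Fin 20) → Fin 10 → Q} (hR : Rel e) (F : Finset (Fin 20)) (hF : Big F)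
    (hc : F.card ≤ 6) (t : Fin 10) : e F t = 0 := by
  by_contra hne
  have h1 := iter_inv hR 10 start start_len (start_inv hR) F hF t hne
  have h2 := lmask_spec 16 le_rfl 6 F hF.bd hc
  have h3 := finalCheck_true
  unfold finalCheck at h3
  generalize iter 10 start = al at h1 h3
  rw [List.all_eq_true] at h3
  by_cases ht : (t : ℕ) < al.length
  · have h4 := h3 (al.getD t 0) (by
      rw [List.getD_eq_getElem _ _ ht]; exact List.getElem_mem ht)
    have h5 : al.getD t 0 &&& lmask 16 6 = 0 := Nat.eq_of_beq_eq_true h4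
    have h6 : (al.getD t 0 &&& lmask 16 6).testBit (enc F) = true := by
      rw [Nat.testBit_and, h1, h2]; rfl
    rw [h5] at h6
    simp at h6
  · rw [List.getD_eq_default _ _ (by omega)] at h1
    simp at h1

/-! ## The monomial model of the Koszul complex -/

noncomputable section

open MvPolynomial in
/-- the exponent vector of the `j`-th cubic monomial -/
def ms (j : Fin 20) : Fin 4 →₀ ℕ := Finsupp.equivFunOnFinite.symm (mon j)

theorem ms_apply (j : Fin 20) (l : Fin 4) : ms j l = mon j l := rfl

/-- the `j`-th cubic monomial -/
def uu (K : Type*) [Field K] (j : Fin 20) : MvPolynomial (Fin 4) K :=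
  MvPolynomial.monomial (ms j) 1

theorem ms_degree (j : Fin 20) : (ms j).degree = 3 := by
  rw [Finsupp.degree_eq_sum]
  simp only [ms_apply]
  revert j
  decide

section model

variable {K : Type*} [Field K]

theorem uu_homog (j : Fin 20) : (uu K j).IsHomogeneous 3 :=
  MvPolynomial.isHomogeneous_monomial _ (ms_degree j)

/-- the Koszul differential -/
def D (c : Finset (Fin 20) → MvPolynomial (Fin 4) K) (F : Finset (Fin 20)) :
    MvPolynomial (Fin 4) K :=
  ∑ j, if j ∈ F then 0 else sgn j F • (uu K j * c (insert j F))

theorem sgn_insert {j k : Fin 20} {F : Finset (Fin 20)} (h : k ∉ F) :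
    sgn j (insert k F) = if k < j then - sgn j F else sgn j F := by
  unfold sgn
  rw [Finset.filter_insert]
  split_ifs with hk
  · rw [Finset.card_insert_of_notMem (by simp [h]), pow_succ]; ring
  · rfl

theorem sgn_min {j : Fin 20} {F : Finset (Fin 20)} (h : ∀ k ∈ F, (j : ℕ) ≤ k) :
    sgn j F = 1 := by
  unfold sgn
  rw [Finset.filter_false_of_mem]
  · rfl
  · intro k hk hlt
    have := h k hk
    have : (k : ℕ) < j := hlt
    omega

theorem D_D [CharZero K] (c : Finset (Fin 20) → MvPolynomial (Fin 4) K) (F : Finset (Fin 20)) :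
    D (D c) F = 0 := by
  let f : Fin 20 → Fin 20 → MvPolynomial (Fin 4) K := fun j k =>
    if j ∈ F ∨ k ∈ F ∨ j = k then 0 else
      (sgn j F * sgn k (insert j F)) • (uu K j * uu K k * c (insert k (insert j F)))
  have h1 : D (D c) F = ∑ j, ∑ k, f j k := by
    unfold D
    refine Finset.sum_congr rfl fun j _ => ?_
    by_cases hj : j ∈ F
    · simp [f, hj]
    · simp only [hj, if_false, Finset.mul_sum, Finset.smul_sum]
      refine Finset.sum_congr rfl fun k _ => ?_
      by_cases hk : k ∈ insert j F
      · have : j ∈ F ∨ k ∈ F ∨ j = k := by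
          rcases Finset.mem_insert.1 hk with h | h
          · exact Or.inr (Or.inr h.symm)
          · exact Or.inr (Or.inl h)
        simp only [f, if_pos hk, if_pos this]
        simp
      · have : ¬ (j ∈ F ∨ k ∈ F ∨ j = k) := by
          rw [Finset.mem_insert] at hk
          tauto
        simp only [f, if_neg hk, if_neg this]
        rw [mul_smul, mul_smul_comm, mul_assoc]
  have h2 : ∀ j k, f j k = - f k j := by
    intro j k
    by_cases h : j ∈ F ∨ k ∈ F ∨ j = k
    · have h' : k ∈ F ∨ j ∈ F ∨ k = j := by tauto
      simp only [f, if_pos h, if_pos h', neg_zero]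
    · have h' : ¬ (k ∈ F ∨ j ∈ F ∨ k = j) := by tauto
      simp only [f, if_neg h, if_neg h']
      push Not at h
      rw [← neg_smul, Finset.insert_comm, mul_comm (uu K j), sgn_insert h.1, sgn_insert h.2.1]
      congr 1
      rcases lt_trichotomy j k with hl | hl | hl
      · rw [if_pos hl, if_neg (not_lt.2 hl.le)]; ring
      · exact absurd hl h.2.2
      · rw [if_pos hl, if_neg (not_lt.2 hl.le)]; ring
  have h3 : ∑ j, ∑ k, f j k = - ∑ j, ∑ k, f j k := by
    conv_lhs => rw [Finset.sum_comm]
    rw [← Finset.sum_neg_distrib]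
    refine Finset.sum_congr rfl fun j _ => ?_
    rw [← Finset.sum_neg_distrib]
    exact Finset.sum_congr rfl fun k _ => h2 _ _
  rw [h1]
  exact self_eq_neg.1 h3

theorem D_sub (c e : Finset (Fin 20) → MvPolynomial (Fin 4) K) (F : Finset (Fin 20)) :
    D (fun F => c F - e F) F = D c F - D e F := by
  unfold D
  rw [← Finset.sum_sub_distrib]
  refine Finset.sum_congr rfl fun j _ => ?_
  split_ifs
  · simp
  · rw [mul_sub, smul_sub]

theorem D_mul (k : Fin 20) (c : Finset (Fin 20) → MvPolynomial (Fin 4) K)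
    (F : Finset (Fin 20)) : D (fun F => uu K k * c F) F = uu K k * D c F := by
  unfold D
  rw [Finset.mul_sum]
  refine Finset.sum_congr rfl fun j _ => ?_
  split_ifs
  · simp
  · rw [mul_smul_comm, mul_left_comm]

theorem D_supp {c : Finset (Fin 20) → MvPolynomial (Fin 4) K} {F : Finset (Fin 20)}
    (h : D c F ≠ 0) : ∃ j, j ∉ F ∧ c (insert j F) ≠ 0 := by
  by_contra hcon
  push Not at hcon
  apply h
  refine Finset.sum_eq_zero fun j _ => ?_
  split_ifs with hj
  · rfl
  · rw [hcon j hj]; simp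

theorem D_homog {c : Finset (Fin 20) → MvPolynomial (Fin 4) K} {b : ℕ}
    (h : ∀ F, (c F).IsHomogeneous b) (F : Finset (Fin 20)) : (D c F).IsHomogeneous (3 + b) := by
  unfold D
  refine MvPolynomial.IsHomogeneous.sum _ _ _ fun j _ => ?_
  split_ifs
  · exact MvPolynomial.isHomogeneous_zero _ _ _
  · have h1 : uu K j * c (insert j F) ∈ MvPolynomial.homogeneousSubmodule (Fin 4) K (3 + b) :=
      (uu_homog j).mul (h _)
    exact zsmul_mem h1 (sgn j F)

/-- polynomials in the monomial ideal generated by the cubes of the first `k` variables -/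
def JJ (K : Type*) [Field K] (k : ℕ) : Submodule K (MvPolynomial (Fin 4) K) where
  carrier := {f | ∀ m : Fin 4 →₀ ℕ, (∀ l : Fin 4, (l : ℕ) < k → m l ≤ 2) →
    MvPolynomial.coeff m f = 0}
  add_mem' := by
    intro f g hf hg m hm
    rw [MvPolynomial.coeff_add, hf m hm, hg m hm, add_zero]
  zero_mem' := by
    intro m _
    simp
  smul_mem' := by
    intro a f hf m hm
    rw [MvPolynomial.coeff_smul, hf m hm, smul_zero]

theorem JJ_mul {k : ℕ} {f : MvPolynomial (Fin 4) K} (hf : f ∈ JJ K k) (j : Fin 20) :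
    uu K j * f ∈ JJ K k := by
  intro m hm
  unfold uu
  rw [MvPolynomial.coeff_monomial_mul']
  split_ifs
  · rw [hf, mul_zero]
    intro l hl
    exact (Nat.sub_le _ _).trans (hm l hl)
  · rfl

theorem JJ_D {k : ℕ} {c : Finset (Fin 20) → MvPolynomial (Fin 4) K} (hc : ∀ F, c F ∈ JJ K k)
    (F : Finset (Fin 20)) : D c F ∈ JJ K k := by
  refine Submodule.sum_mem _ fun j _ => ?_
  split_ifs
  · exact Submodule.zero_mem _
  · exact zsmul_mem (JJ_mul (hc _) _) _

theorem JJ_mono {k : ℕ} {f : MvPolynomial (Fin 4) K} (hf : f ∈ JJ K k) : f ∈ JJ K (k + 1) :=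
  fun m hm => hf m fun l hl => hm l (by omega)

theorem mon_cube (k : Fin 4) (l : Fin 4) :
    mon ⟨k, by omega⟩ l = if l = k then 3 else 0 := by
  revert k l
  decide

theorem JJ_cube (k : Fin 4) (f : MvPolynomial (Fin 4) K) :
    uu K ⟨k, by omega⟩ * f ∈ JJ K (k + 1) := by
  intro m hm
  unfold uu
  rw [MvPolynomial.coeff_monomial_mul', if_neg]
  intro h
  have h1 := h k
  rw [ms_apply, mon_cube, if_pos rfl] at h1
  have := hm k (by omega)
  omega

theorem cube_le (k : Fin 4) {m : Fin 4 →₀ ℕ} (h : 3 ≤ m k) : ms ⟨k, by omega⟩ ≤ m := by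
  intro l
  rw [ms_apply, mon_cube]
  split_ifs with hl
  · rw [hl]; exact h
  · exact Nat.zero_le _

theorem JJ_cancel (k : Fin 4) {f : MvPolynomial (Fin 4) K}
    (h : uu K ⟨k, by omega⟩ * f ∈ JJ K k) : f ∈ JJ K k := by
  intro m hm
  have := h (ms ⟨k, by omega⟩ + m) (by
    intro l hl
    rw [Finsupp.add_apply, ms_apply, mon_cube, if_neg, zero_add]
    · exact hm l hl
    · rintro rfl; omega)
  unfold uu at this
  rw [MvPolynomial.coeff_monomial_mul', if_pos (le_add_of_nonneg_right (zero_le)),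
    add_tsub_cancel_left, one_mul] at this
  exact this

theorem JJ_div (k : Fin 4) {f : MvPolynomial (Fin 4) K} (h : f ∈ JJ K (k + 1)) :
    f - uu K ⟨k, by omega⟩ * f.divMonomial (ms ⟨k, by omega⟩) ∈ JJ K k := by
  intro m hm
  unfold uu
  rw [MvPolynomial.coeff_sub, MvPolynomial.coeff_monomial_mul']
  split_ifs with hk
  · rw [MvPolynomial.coeff_divMonomial, add_tsub_cancel_of_le hk, one_mul, sub_self]
  · rw [sub_zero]
    refine h m fun l hl => ?_
    by_cases hlk : l = k
    · by_contra hcon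
      exact hk (cube_le k (by rw [← hlk]; omega))
    · exact hm l (by
        have : (l : ℕ) ≠ k := fun h => hlk (Fin.ext h)
        omega)

theorem div_homog (k : Fin 20) {f : MvPolynomial (Fin 4) K} {b : ℕ} (h : f.IsHomogeneous b) :
    (f.divMonomial (ms k)).IsHomogeneous (b - 3) := by
  intro m hm
  rw [MvPolynomial.coeff_divMonomial] at hm
  have h1 := h hm
  rw [map_add] at h1
  have h2 : Finsupp.weight (1 : Fin 4 → ℕ) (ms k) = 3 := by
    exact (DFunLike.congr_fun (Finsupp.degree_eq_weight_one (R := ℕ)) (ms k)).symm.trans (ms_degree k)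
  omega

/-- exactness modulo the first `k` cubes -/
def Ex (K : Type*) [Field K] (k i b : ℕ) : Prop :=
  ∀ c : Finset (Fin 20) → MvPolynomial (Fin 4) K,
    (∀ F, c F ≠ 0 → (∀ j ∈ F, k ≤ (j : ℕ)) ∧ F.card = i) → (∀ F, (c F).IsHomogeneous b) →
    (∀ F, D c F ∈ JJ K k) →
    ∃ e : Finset (Fin 20) → MvPolynomial (Fin 4) K,
      (∀ F, e F ≠ 0 → (∀ j ∈ F, k ≤ (j : ℕ)) ∧ F.card = i + 1) ∧
      (∀ F, (e F).IsHomogeneous (b - 3)) ∧ ∀ F, c F - D e F ∈ JJ K k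

theorem Ex_step [CharZero K] (k : Fin 4) {i b : ℕ} (hb : 3 ≤ b) (H : Ex K (k + 1) i b) :
    Ex K k i b := by
  intro c hsupp hhom hcyc
  obtain ⟨kk, hkk⟩ : ∃ kk : Fin 20, kk = ⟨k, by omega⟩ := ⟨_, rfl⟩
  have hkv : (kk : ℕ) = k := by rw [hkk]
  set a : Finset (Fin 20) → MvPolynomial (Fin 4) K := fun F => if kk ∈ F then 0 else c F with ha
  -- splitting of `D c`
  have hDc : ∀ F, kk ∉ F → D c F = D a F + uu K kk * c (insert kk F) := by
    intro F hF
    have hs : sgn kk F • (uu K kk * c (insert kk F)) = uu K kk * c (insert kk F) := by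
      by_cases h0 : c (insert kk F) = 0
      · rw [h0]; simp
      · rw [sgn_min, one_smul]
        intro l hl
        rw [hkv]
        exact (hsupp _ h0).1 l (Finset.mem_insert_of_mem hl)
    rw [← hs]
    unfold D
    rw [← Finset.add_sum_erase _ _ (Finset.mem_univ kk),
      ← Finset.add_sum_erase _ (fun j => if j ∈ F then 0 else _) (Finset.mem_univ kk)]
    simp only [hF, if_false]
    have : a (insert kk F) = 0 := by simp [ha]
    rw [this, mul_zero, smul_zero, zero_add, add_comm]
    congr 1
    refine Finset.sum_congr rfl fun j hj => ?_
    have hjk : j ≠ kk := Finset.ne_of_mem_erase hj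
    split_ifs
    · rfl
    · congr 2
      simp only [ha]
      rw [if_neg]
      rw [Finset.mem_insert]
      rintro (h | h)
      · exact hjk h.symm
      · exact hF h
  have hDa0 : ∀ e : Finset (Fin 20) → MvPolynomial (Fin 4) K, (∀ F, kk ∈ F → e F = 0) →
      ∀ F, kk ∈ F → D e F = 0 := by
    intro e he F hF
    by_contra h
    obtain ⟨j, _, h2⟩ := D_supp h
    exact h2 (he _ (Finset.mem_insert_of_mem hF))
  have ha0 : ∀ F, kk ∈ F → a F = 0 := fun F hF => by simp [ha, hF]
  have hsa : ∀ F, a F ≠ 0 → (∀ j ∈ F, (k : ℕ) + 1 ≤ (j : ℕ)) ∧ F.card = i := by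
    intro F hF
    have hk : kk ∉ F := fun h => hF (ha0 F h)
    have hc : c F ≠ 0 := by simpa [ha, hk] using hF
    refine ⟨fun j hj => ?_, (hsupp F hc).2⟩
    have h1 := (hsupp F hc).1 j hj
    have h2 : (j : ℕ) ≠ k := fun h => hk (by
      have : kk = j := Fin.ext (by omega)
      rw [this]; exact hj)
    omega
  obtain ⟨c', hc's, hc'h, hc'⟩ := H a hsa (by
      intro F
      simp only [ha]
      split_ifs
      · exact MvPolynomial.isHomogeneous_zero _ _ _
      · exact hhom F) (by
      intro F
      by_cases hF : kk ∈ F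
      · rw [hDa0 a ha0 F hF]; exact Submodule.zero_mem _
      · have h1 := hDc F hF
        have h2 : D a F = D c F - uu K kk * c (insert kk F) := by rw [h1]; ring
        rw [h2]
        refine Submodule.sub_mem _ (JJ_mono (hcyc F)) ?_
        rw [hkk]
        exact JJ_cube k _)
  have hc'0 : ∀ F, kk ∈ F → c' F = 0 := by
    intro F hF
    by_contra h
    have := (hc's F h).1 kk hF
    omega
  set r : Finset (Fin 20) → MvPolynomial (Fin 4) K := fun F => a F - D c' F with hr
  have hr0 : ∀ F, kk ∈ F → r F = 0 := by
    intro F hF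
    simp only [hr]
    rw [ha0 F hF, hDa0 c' hc'0 F hF, sub_zero]
  have hrs : ∀ F, r F ≠ 0 → (∀ j ∈ F, (k : ℕ) + 1 ≤ (j : ℕ)) ∧ F.card = i := by
    intro F hF
    by_cases h1 : a F = 0
    · have h2 : D c' F ≠ 0 := by
        intro h2
        apply hF
        simp only [hr]
        rw [h1, h2, sub_zero]
      obtain ⟨j, hj, h3⟩ := D_supp h2
      have h4 := hc's _ h3
      rw [Finset.card_insert_of_notMem hj] at h4
      exact ⟨fun l hl => h4.1 l (Finset.mem_insert_of_mem hl), by omega⟩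
    · exact hsa F h1
  have hrh : ∀ F, (r F).IsHomogeneous b := by
    intro F
    refine MvPolynomial.IsHomogeneous.sub ?_ ?_
    · simp only [ha]
      split_ifs
      · exact MvPolynomial.isHomogeneous_zero _ _ _
      · exact hhom F
    · have := D_homog hc'h F
      rwa [show 3 + (b - 3) = b by omega] at this
  set e : Finset (Fin 20) → MvPolynomial (Fin 4) K := fun F => (r F).divMonomial (ms kk) with he
  have hes : ∀ F, e F ≠ 0 → (∀ j ∈ F, (k : ℕ) + 1 ≤ (j : ℕ)) ∧ F.card = i := by
    intro F hF
    apply hrs F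
    intro h
    apply hF
    simp [he, h]
  have he0 : ∀ F, kk ∈ F → e F = 0 := by
    intro F hF
    by_contra h
    have := (hes F h).1 kk hF
    omega
  have hre : ∀ F, r F - uu K kk * e F ∈ JJ K k := by
    intro F
    have := JJ_div k (hc' F)
    simp only [he]
    rw [hkk]
    exact this
  -- the correction term
  have hbe : ∀ F, kk ∉ F → c (insert kk F) + D e F ∈ JJ K k := by
    intro F hF
    apply JJ_cancel k
    rw [← hkk]
    have h1 := D_sub r (fun F => uu K kk * e F) F
    rw [D_mul] at h1
    have h2 := D_sub a (D c') F
    rw [D_D, sub_zero] at h2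
    have h3 := hDc F hF
    have h4 : uu K kk * (c (insert kk F) + D e F) =
        D c F - D (fun F => r F - uu K kk * e F) F := by
      rw [h1, h3, ← h2]; ring
    rw [h4]
    exact Submodule.sub_mem _ (hcyc F) (JJ_D hre F)
  refine ⟨fun F => if kk ∈ F then e (F.erase kk) else c' F, ?_, ?_, ?_⟩
  · intro F hF
    by_cases hk : kk ∈ F
    · simp only [hk, if_true] at hF
      have := hes _ hF
      refine ⟨fun j hj => ?_, ?_⟩
      · by_cases hjk : j = kk
        · rw [hjk, hkv]
        · have := this.1 j (Finset.mem_erase.2 ⟨hjk, hj⟩)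
          omega
      · rw [← this.2, Finset.card_erase_add_one hk]
    · simp only [hk, if_false] at hF
      have := hc's F hF
      exact ⟨fun j hj => by have := this.1 j hj; omega, this.2⟩
  · intro F
    dsimp only
    split_ifs
    · exact div_homog kk (hrh _)
    · exact hc'h F
  · intro F
    by_cases hk : kk ∈ F
    · have hF : insert kk (F.erase kk) = F := Finset.insert_erase hk
      have h1 : D (fun F => if kk ∈ F then e (F.erase kk) else c' F) F = - D e (F.erase kk) := by
        unfold D
        rw [← Finset.sum_neg_distrib]
        refine Finset.sum_congr rfl fun j _ => ?_
        by_cases hj : j ∈ F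
        · rw [if_pos hj]
          by_cases hjk : j = kk
          · rw [he0 (insert j (F.erase kk)) (by rw [hjk]; exact Finset.mem_insert_self _ _)]
            simp
          · rw [if_pos (Finset.mem_erase.2 ⟨hjk, hj⟩), neg_zero]
        · have hjk : j ≠ kk := by rintro rfl; exact hj hk
          rw [if_neg hj, if_neg (fun h => hj (Finset.mem_of_mem_erase h))]
          dsimp only
          rw [if_pos (Finset.mem_insert_of_mem hk), Finset.erase_insert_of_ne hjk]
          by_cases h0 : e (insert j (F.erase kk)) = 0
          · rw [h0]; simp
          · have h3 := (hes _ h0).1 j (Finset.mem_insert_self _ _)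
            have h4 := sgn_insert (j := j) (Finset.notMem_erase kk F)
            rw [hF, if_pos (show kk < j by rw [Fin.lt_def]; omega)] at h4
            rw [h4, neg_smul]
      rw [h1, sub_neg_eq_add]
      have := hbe (F.erase kk) (Finset.notMem_erase kk F)
      rwa [hF] at this
    · have h1 : D (fun F => if kk ∈ F then e (F.erase kk) else c' F) F =
          D c' F + uu K kk * e F := by
        have hs : sgn kk F • (uu K kk * e F) = uu K kk * e F := by
          by_cases h0 : e F = 0
          · rw [h0]; simp
          · rw [sgn_min, one_smul]
            intro l hl
            have := (hes _ h0).1 l hl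
            omega
        rw [← hs]
        unfold D
        rw [← Finset.add_sum_erase _ _ (Finset.mem_univ kk),
          ← Finset.add_sum_erase _ (fun j => if j ∈ F then 0 else sgn j F • (uu K j * c' (insert j F)))
            (Finset.mem_univ kk)]
        simp only [hk, if_false]
        rw [if_pos (Finset.mem_insert_self _ _), hc'0 (insert kk F) (Finset.mem_insert_self _ _),
          mul_zero, smul_zero, zero_add, Finset.erase_insert hk, add_comm]
        congr 1
        refine Finset.sum_congr rfl fun j hj => ?_
        have hjk : j ≠ kk := Finset.ne_of_mem_erase hj
        split_ifs with h1 h2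
        · rfl
        · rcases Finset.mem_insert.1 h2 with h | h
          · exact absurd h.symm hjk
          · exact absurd h hk
        · rfl
      have h2 := hre F
      simp only [hr, ha, hk, if_false] at h2
      rw [h1, ← sub_sub]
      exact h2

theorem Ex_zero [CharZero K] {i b : ℕ} (hb : 3 ≤ b) (H : Ex K 4 i b) : Ex K 0 i b :=
  Ex_step 0 hb (Ex_step 1 hb (Ex_step 2 hb (Ex_step 3 hb H)))

end model

end

/-! ## The Artinian case -/

noncomputable section

section artin

variable {K : Type*} [Field K]

/-- the exponent vector of the `t`-th monomial of degree six -/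
def ms6 (t : Fin 10) : Fin 4 →₀ ℕ := Finsupp.equivFunOnFinite.symm (mon6 t)

theorem D_add (c e : Finset (Fin 20) → MvPolynomial (Fin 4) K) (F : Finset (Fin 20)) :
    D (c + e) F = D c F + D e F := by
  unfold D
  rw [← Finset.sum_add_distrib]
  refine Finset.sum_congr rfl fun j _ => ?_
  split_ifs
  · simp
  · rw [Pi.add_apply, mul_add, smul_add]

theorem D_smul (a : K) (c : Finset (Fin 20) → MvPolynomial (Fin 4) K) (F : Finset (Fin 20)) :
    D (a • c) F = a • D c F := by
  unfold D
  rw [Finset.smul_sum]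
  refine Finset.sum_congr rfl fun j _ => ?_
  split_ifs
  · simp
  · rw [Pi.smul_apply, mul_smul_comm, smul_comm]

theorem sgn_erase (j : Fin 20) (G : Finset (Fin 20)) : sgn j (G.erase j) = sgn j G := by
  unfold sgn
  congr 2
  ext k
  simp only [Finset.mem_filter, Finset.mem_erase]
  constructor
  · rintro ⟨⟨_, h⟩, h2⟩; exact ⟨h, h2⟩
  · rintro ⟨h, h2⟩; exact ⟨⟨h2.ne, h⟩, h2⟩

theorem D_single (G : Finset (Fin 20)) (w : MvPolynomial (Fin 4) K) :
    D (Pi.single G w) =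
      ∑ j ∈ G, sgn j G • (Pi.single (G.erase j) (uu K j * w) : Finset (Fin 20) → _) := by
  funext F
  unfold D
  rw [Finset.sum_apply, ← Finset.sum_filter_add_sum_filter_not Finset.univ (· ∈ G)]
  rw [Finset.filter_univ_mem]
  rw [Finset.sum_eq_zero (s := Finset.univ.filter (fun x => x ∉ G)), add_zero]
  · refine Finset.sum_congr rfl fun j hj => ?_
    rw [Pi.smul_apply]
    by_cases hF : F = G.erase j
    · subst hF
      rw [if_neg (Finset.notMem_erase _ _), Finset.insert_erase hj, sgn_erase,
        Pi.single_eq_same, Pi.single_eq_same]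
    · rw [Pi.single_eq_of_ne hF, smul_zero]
      split_ifs with h
      · rfl
      · rw [Pi.single_eq_of_ne, mul_zero, smul_zero]
        intro h2
        apply hF
        rw [← h2, Finset.erase_insert h]
  · intro j hj
    split_ifs with h
    · rfl
    · rw [Pi.single_eq_of_ne, mul_zero, smul_zero]
      intro h2
      apply (Finset.mem_filter.1 hj).2
      rw [← h2]
      exact Finset.mem_insert_self _ _

theorem deg_eq (m : Fin 4 →₀ ℕ) : Finsupp.weight (1 : Fin 4 → ℕ) m = m 0 + m 1 + m 2 + m 3 := by
  have h : Finsupp.weight (1 : Fin 4 → ℕ) m = m.degree :=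
    (DFunLike.congr_fun (Finsupp.degree_eq_weight_one (R := ℕ)) m).symm
  rw [h, Finsupp.degree_eq_sum, Fin.sum_univ_four]

theorem mem_JJ_of_large {f : MvPolynomial (Fin 4) K} {b : ℕ} (hb : 9 ≤ b)
    (h : f.IsHomogeneous b) : f ∈ JJ K 4 := by
  intro m hm
  by_contra hc
  have h1 := h hc
  rw [deg_eq] at h1
  have h0 := hm 0 (by simp)
  have h2 := hm 1 (by simp)
  have h3 := hm 2 (by simp)
  have h4 := hm 3 (by simp)
  omega

theorem ms6_surj_aux : ∀ a b c d : Fin 3, (a : ℕ) + b + c + d = 6 →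
    ∃ t, mon6 t = ![(a : ℕ), b, c, d] := by decide

theorem ms6_surj {m : Fin 4 →₀ ℕ} (hm : ∀ l : Fin 4, (l : ℕ) < 4 → m l ≤ 2)
    (h : m 0 + m 1 + m 2 + m 3 = 6) : ∃ t, m = ms6 t := by
  have h0 := hm 0 (by simp)
  have h2 := hm 1 (by simp)
  have h3 := hm 2 (by simp)
  have h4 := hm 3 (by simp)
  obtain ⟨t, ht⟩ := ms6_surj_aux ⟨m 0, by omega⟩ ⟨m 1, by omega⟩ ⟨m 2, by omega⟩ ⟨m 3, by omega⟩ h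
  refine ⟨t, ?_⟩
  ext l
  change m l = mon6 t l
  rw [ht]
  fin_cases l <;> rfl

theorem mon6_inj : ∀ s t, mon6 s = mon6 t → s = t := by decide

theorem ms6_inj {s t : Fin 10} (h : ms6 s = ms6 t) : s = t :=
  mon6_inj s t (Finsupp.equivFunOnFinite.symm.injective h)

theorem mon6_deg : ∀ t, mon6 t 0 + mon6 t 1 + mon6 t 2 + mon6 t 3 = 6 := by decide

/-- reduction of a sextic modulo the cubes -/
theorem red6 {f : MvPolynomial (Fin 4) K} (h : f.IsHomogeneous 6) :
    f - ∑ t, f.coeff (ms6 t) • MvPolynomial.monomial (ms6 t) (1 : K) ∈ JJ K 4 := by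
  intro m hm
  rw [MvPolynomial.coeff_sub, MvPolynomial.coeff_sum]
  simp only [MvPolynomial.coeff_smul, MvPolynomial.coeff_monomial]
  by_cases hd : m 0 + m 1 + m 2 + m 3 = 6
  · obtain ⟨s, rfl⟩ := ms6_surj hm hd
    rw [Finset.sum_eq_single s]
    · simp
    · intro t _ hts
      rw [if_neg (fun h => hts (ms6_inj h)), smul_zero]
    · simp
  · have h1 : f.coeff m = 0 := by
      by_contra hc
      have := h hc
      rw [deg_eq] at this
      exact hd this
    rw [h1, Finset.sum_eq_zero, sub_zero]
    intro t _
    rw [if_neg, smul_zero]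
    rintro rfl
    apply hd
    change mon6 t 0 + mon6 t 1 + mon6 t 2 + mon6 t 3 = 6
    exact mon6_deg t

/-- the chains that are boundaries of non-cube chains modulo the cubes -/
def NN (K : Type*) [Field K] : Submodule K (Finset (Fin 20) → MvPolynomial (Fin 4) K) where
  carrier := {c | ∃ e : Finset (Fin 20) → MvPolynomial (Fin 4) K,
    (∀ F, e F ≠ 0 → Big F) ∧ (∀ F, (e F).IsHomogeneous 3) ∧ ∀ F, c F - D e F ∈ JJ K 4}
  zero_mem' := by
    refine ⟨0, fun F h => absurd rfl h, fun F => MvPolynomial.isHomogeneous_zero _ _ _,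
      fun F => ?_⟩
    have : D (0 : Finset (Fin 20) → MvPolynomial (Fin 4) K) F = 0 := by simp [D]
    rw [this]
    simp
  add_mem' := by
    rintro c c' ⟨e, h1, h2, h3⟩ ⟨e', h1', h2', h3'⟩
    refine ⟨e + e', fun F h => ?_, fun F => (h2 F).add (h2' F), fun F => ?_⟩
    · by_cases h0 : e F = 0
      · apply h1' F
        intro h0'
        apply h
        rw [Pi.add_apply, h0, h0', add_zero]
      · exact h1 F h0
    · rw [D_add, Pi.add_apply, add_sub_add_comm]
      exact Submodule.add_mem _ (h3 F) (h3' F)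
  smul_mem' := by
    rintro a c ⟨e, h1, h2, h3⟩
    refine ⟨a • e, fun F h => h1 F ?_, fun F => ?_, fun F => ?_⟩
    · intro h0
      apply h
      rw [Pi.smul_apply, h0, smul_zero]
    · have h4 : e F ∈ MvPolynomial.homogeneousSubmodule (Fin 4) K 3 := h2 F
      exact Submodule.smul_mem _ a h4
    · rw [D_smul, Pi.smul_apply, ← smul_sub]
      exact Submodule.smul_mem _ a (h3 F)

theorem NN_of_JJ {c : Finset (Fin 20) → MvPolynomial (Fin 4) K} (h : ∀ F, c F ∈ JJ K 4) :
    c ∈ NN K := by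
  refine ⟨0, fun F h => absurd rfl h, fun F => MvPolynomial.isHomogeneous_zero _ _ _,
      fun F => ?_⟩
  have : D (0 : Finset (Fin 20) → MvPolynomial (Fin 4) K) F = 0 := by simp [D]
  rw [this, sub_zero]
  exact h F

theorem torsionFree_of_charZero (K : Type*) [Field K] [CharZero K] (Q : Type*) [AddCommGroup Q]
    [Module K Q] : IsAddTorsionFree Q where
  nsmul_right_injective n hn x y hxy := by
    have hxy' : n • x = n • y := hxy
    rw [← Nat.cast_smul_eq_nsmul K n x, ← Nat.cast_smul_eq_nsmul K n y] at hxy'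
    exact smul_right_injective Q (Nat.cast_ne_zero.2 hn) hxy'

/-- the class of a generator in the quotient -/
def gen (K : Type*) [Field K] (F : Finset (Fin 20)) (t : Fin 10) :
    (Finset (Fin 20) → MvPolynomial (Fin 4) K) ⧸ NN K :=
  (NN K).mkQ (Pi.single F (MvPolynomial.monomial (ms6 t) (1 : K)))

theorem JJ_single {G : Finset (Fin 20)} {f : MvPolynomial (Fin 4) K} (h : f ∈ JJ K 4)
    (F : Finset (Fin 20)) :
    (Pi.single G f : Finset (Fin 20) → MvPolynomial (Fin 4) K) F ∈ JJ K 4 := by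
  by_cases hF : F = G
  · subst hF; rwa [Pi.single_eq_same]
  · rw [Pi.single_eq_of_ne hF]; exact Submodule.zero_mem _

theorem gen_rel (K : Type*) [Field K] : Rel (gen K) := by
  intro G hG m hm
  have key : ∑ j ∈ G, ∑ t : Fin 10, (if mon j + mon m = mon6 t then
      sgn j G • (Pi.single (G.erase j) (MvPolynomial.monomial (ms6 t) (1 : K)) :
        Finset (Fin 20) → MvPolynomial (Fin 4) K) else 0) ∈ NN K := by
    have h1 : D (Pi.single G (uu K m)) ∈ NN K := by
      refine ⟨Pi.single G (uu K m), fun F hF => ?_, fun F => ?_, fun F => ?_⟩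
      · by_cases h : F = G
        · subst h; exact hG
        · exact absurd (Pi.single_eq_of_ne h _) hF
      · by_cases h : F = G
        · subst h; rw [Pi.single_eq_same]; exact uu_homog m
        · rw [Pi.single_eq_of_ne h]; exact MvPolynomial.isHomogeneous_zero _ _ _
      · rw [sub_self]; exact Submodule.zero_mem _
    rw [← Submodule.sub_mem_iff_left _ h1, D_single, ← Finset.sum_sub_distrib]
    refine Submodule.sum_mem _ fun j hj => ?_
    have h2 : (∑ t : Fin 10, (if mon j + mon m = mon6 t then
        sgn j G • (Pi.single (G.erase j) (MvPolynomial.monomial (ms6 t) (1 : K)) :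
        Finset (Fin 20) → MvPolynomial (Fin 4) K) else 0)) =
        sgn j G • (Pi.single (G.erase j) (∑ t : Fin 10,
          (uu K j * uu K m).coeff (ms6 t) • MvPolynomial.monomial (ms6 t) (1 : K)) :
          Finset (Fin 20) → MvPolynomial (Fin 4) K) := by
      have h3 := map_sum (LinearMap.single K (fun _ : Finset (Fin 20) => MvPolynomial (Fin 4) K)
        (G.erase j)) (fun t : Fin 10 =>
          (uu K j * uu K m).coeff (ms6 t) • MvPolynomial.monomial (ms6 t) (1 : K)) Finset.univ
      simp only [LinearMap.coe_single] at h3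
      rw [h3, Finset.smul_sum]
      refine Finset.sum_congr rfl fun t _ => ?_
      unfold uu
      rw [MvPolynomial.monomial_mul, MvPolynomial.coeff_monomial, one_mul]
      have hiff : (ms j + ms m = ms6 t) ↔ mon j + mon m = mon6 t := by
        constructor
        · intro h
          funext l
          exact DFunLike.congr_fun h l
        · intro h
          ext l
          exact congrFun h l
      by_cases h : mon j + mon m = mon6 t
      · rw [if_pos h, if_pos (hiff.2 h), one_smul]
      · rw [if_neg h, if_neg (fun h' => h (hiff.1 h')), zero_smul, Pi.single_zero, smul_zero]
    rw [h2, ← smul_sub, ← Pi.single_sub]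
    refine zsmul_mem ?_ _
    apply NN_of_JJ
    apply JJ_single
    have h4 := red6 ((uu_homog (K := K) j).mul (uu_homog m))
    have h5 := Submodule.neg_mem _ h4
    rwa [neg_sub] at h5
  have := (Submodule.Quotient.mk_eq_zero (NN K)).2 key
  rw [← Submodule.mkQ_apply, map_sum] at this
  refine Eq.trans ?_ this
  refine Finset.sum_congr rfl fun j _ => ?_
  rw [map_sum]
  refine Finset.sum_congr rfl fun t _ => ?_
  split_ifs
  · rw [map_zsmul]; rfl
  · rw [map_zero]

theorem single_mem_NN [CharZero K] {F : Finset (Fin 20)} (hF : Big F) (hc : F.card ≤ 6)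
    {f : MvPolynomial (Fin 4) K} (hf : f.IsHomogeneous 6) :
    (Pi.single F f : Finset (Fin 20) → MvPolynomial (Fin 4) K) ∈ NN K := by
  have h1 := NN_of_JJ (JJ_single (G := F) (red6 hf))
  rw [Pi.single_sub] at h1
  rw [Submodule.sub_mem_iff_left] at h1
  · exact h1
  · have h3 := map_sum (LinearMap.single K (fun _ : Finset (Fin 20) => MvPolynomial (Fin 4) K)
        F) (fun t : Fin 10 =>
          f.coeff (ms6 t) • MvPolynomial.monomial (ms6 t) (1 : K)) Finset.univ
    simp only [map_smul, LinearMap.coe_single] at h3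
    rw [h3]
    refine Submodule.sum_mem _ fun t _ => Submodule.smul_mem _ _ ?_
    have := torsionFree_of_charZero K ((Finset (Fin 20) → MvPolynomial (Fin 4) K) ⧸ NN K)
    exact (Submodule.Quotient.mk_eq_zero (NN K)).1 (core (gen_rel K) F hF hc t)

theorem Ex_four_six [CharZero K] {i : ℕ} (hi : i ≤ 6) : Ex K 4 i 6 := by
  intro c hs hh _
  have h1 : c ∈ NN K := by
    rw [← Finset.univ_sum_single c]
    refine Submodule.sum_mem _ fun F _ => ?_
    by_cases h0 : c F = 0
    · rw [h0, Pi.single_zero]; exact Submodule.zero_mem _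
    · exact single_mem_NN (hs F h0).1 ((hs F h0).2.trans_le hi) (hh F)
  obtain ⟨e, he1, he2, he3⟩ := h1
  refine ⟨fun F => if F.card = i + 1 then e F else 0, fun F hF => ?_, fun F => ?_, fun F => ?_⟩
  · dsimp only at hF
    split_ifs at hF with h
    · exact ⟨he1 F hF, h⟩
    · exact absurd rfl hF
  · dsimp only
    split_ifs
    · exact he2 F
    · exact MvPolynomial.isHomogeneous_zero _ _ _
  · by_cases h : F.card = i
    · have : D (fun F => if F.card = i + 1 then e F else 0) F = D e F := by
        unfold D
        refine Finset.sum_congr rfl fun j _ => ?_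
        split_ifs with h1
        · rfl
        · dsimp only
          rw [if_pos (by rw [Finset.card_insert_of_notMem h1]; omega)]
      rw [this]
      exact he3 F
    · have h2 : D (fun F => if F.card = i + 1 then e F else 0) F = 0 := by
        by_contra hD
        obtain ⟨j, hj, h3⟩ := D_supp hD
        apply h3
        rw [Finset.card_insert_of_notMem hj, if_neg (by omega)]
      have h3 : c F = 0 := by
        by_contra h0
        exact h (hs F h0).2
      rw [h2, h3, sub_zero]
      exact Submodule.zero_mem _

theorem Ex_four_large {i b : ℕ} (hb : 9 ≤ b) : Ex K 4 i b := by
  intro c hs hh _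
  refine ⟨0, fun F h => absurd rfl h, fun F => MvPolynomial.isHomogeneous_zero _ _ _,
      fun F => ?_⟩
  have : D (0 : Finset (Fin 20) → MvPolynomial (Fin 4) K) F = 0 := by simp [D]
  rw [this, sub_zero]
  exact mem_JJ_of_large hb (hh F)

theorem exact_model [CharZero K] {i q : ℕ} (hi : i ≤ 6) (hq : 2 ≤ q) : Ex K 0 i (q * 3) := by
  apply Ex_zero (by omega)
  by_cases h : q = 2
  · subst h; exact Ex_four_six hi
  · exact Ex_four_large (by omega)

end artin

end

/-! ## Transfer to the exterior powers -/

noncomputable section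

section transfer

variable (K : Type*) [Field K]

theorem mon_surj_aux : ∀ a b c d : Fin 4, (a : ℕ) + b + c + d = 3 →
    ∃ j, mon j = ![(a : ℕ), b, c, d] := by decide

theorem ms_surj {m : Fin 4 →₀ ℕ} (h : m 0 + m 1 + m 2 + m 3 = 3) : ∃ j, m = ms j := by
  obtain ⟨t, ht⟩ := mon_surj_aux ⟨m 0, by omega⟩ ⟨m 1, by omega⟩ ⟨m 2, by omega⟩ ⟨m 3, by omega⟩ h
  refine ⟨t, ?_⟩
  ext l
  rw [ms_apply, ht]
  fin_cases l <;> rfl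

theorem mon_inj : ∀ s t, mon s = mon t → s = t := by decide

theorem ms_inj : Function.Injective ms := fun s t h =>
  mon_inj s t (Finsupp.equivFunOnFinite.symm.injective h)

/-- the cubic monomials as elements of `S_3` -/
def vv (j : Fin 20) : S K 3 3 := ⟨uu K j, uu_homog j⟩

theorem vv_indep : LinearIndependent K (vv K) := by
  apply LinearIndependent.of_comp (S K 3 3).subtype
  have h := (MvPolynomial.basisMonomials (Fin 4) K).linearIndependent.comp ms ms_inj
  have h2 : (S K 3 3).subtype ∘ vv K = ⇑(MvPolynomial.basisMonomials (Fin 4) K) ∘ ms := by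
    funext j
    simp [vv, uu]
  rw [h2]
  exact h

theorem vv_span : ⊤ ≤ Submodule.span K (Set.range (vv K)) := by
  rintro f -
  have h : f = ∑ j, (f : MvPolynomial (Fin 4) K).coeff (ms j) • vv K j := by
    apply Subtype.ext
    rw [Submodule.coe_sum]
    refine MvPolynomial.ext _ _ fun m => ?_
    rw [MvPolynomial.coeff_sum]
    simp only [Submodule.coe_smul, vv, uu, MvPolynomial.coeff_smul, MvPolynomial.coeff_monomial]
    by_cases hd : m 0 + m 1 + m 2 + m 3 = 3
    · obtain ⟨s, rfl⟩ := ms_surj hd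
      rw [Finset.sum_eq_single s]
      · simp
      · intro t _ hts
        rw [if_neg (fun h => hts (ms_inj h)), smul_zero]
      · simp
    · have h1 : (f : MvPolynomial (Fin 4) K).coeff m = 0 := by
        by_contra hc
        have := ((MvPolynomial.mem_homogeneousSubmodule _ _).1 f.2) hc
        rw [deg_eq] at this
        exact hd this
      rw [h1, Finset.sum_eq_zero]
      intro t _
      rw [if_neg, smul_zero]
      rintro rfl
      apply hd
      have := ms_degree t
      rwa [Finsupp.degree_eq_sum, Fin.sum_univ_four] at this
  rw [h]
  exact Submodule.sum_mem _ fun j _ => Submodule.smul_mem _ _ (Submodule.subset_span ⟨j, rfl⟩)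

/-- the monomial basis of `S_3` -/
def BB : Module.Basis (Fin 20) K (S K 3 3) := Module.Basis.mk (vv_indep K) (vv_span K)

theorem BB_apply (j : Fin 20) : BB K j = vv K j := by
  unfold BB
  rw [Module.Basis.mk_apply]

/-- the induced basis of the exterior power -/
abbrev EB (a : ℕ) : Module.Basis (Set.powersetCard (Fin 20) a) K (⋀[K]^a (S K 3 3)) :=
  (BB K).exteriorPower a

/-- coordinates of a Koszul chain -/
def Phi (a b : ℕ) : ((⋀[K]^a (S K 3 3)) ⊗[K] (S K 3 b)) →ₗ[K]
    (Finset (Fin 20) → MvPolynomial (Fin 4) K) :=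
  TensorProduct.lift (LinearMap.mk₂ K
    (fun x w F => if h : F.card = a then
      (EB K a).repr x ⟨F, h⟩ • (w : MvPolynomial (Fin 4) K) else 0)
    (by
      intro x y w; funext F; simp only [Pi.add_apply]; split_ifs
      · rw [map_add, Finsupp.add_apply, add_smul]
      · rw [add_zero])
    (by
      intro r x w; funext F; simp only [Pi.smul_apply]; split_ifs
      · rw [map_smul, Finsupp.smul_apply, smul_assoc]
      · rw [smul_zero])
    (by
      intro x w w'; funext F; simp only [Pi.add_apply]; split_ifs
      · rw [Submodule.coe_add, smul_add]
      · rw [add_zero])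
    (by
      intro r x w; funext F; simp only [Pi.smul_apply]; split_ifs
      · rw [Submodule.coe_smul, smul_comm]
      · rw [smul_zero]))

theorem Phi_tmul {a b : ℕ} (x : ⋀[K]^a (S K 3 3)) (w : S K 3 b) (F : Finset (Fin 20)) :
    Phi K a b (x ⊗ₜ w) F = if h : F.card = a then
      (EB K a).repr x ⟨F, h⟩ • (w : MvPolynomial (Fin 4) K) else 0 := rfl

theorem Phi_basis {a b : ℕ} (G : Set.powersetCard (Fin 20) a) (w : S K 3 b) :
    Phi K a b (EB K a G ⊗ₜ w) = Pi.single (G : Finset (Fin 20)) (w : MvPolynomial (Fin 4) K) := by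
  funext F
  rw [Phi_tmul, Module.Basis.repr_self]
  by_cases hF : F = (G : Finset (Fin 20))
  · subst hF
    have hG : (G : Finset (Fin 20)).card = a := G.2
    rw [dif_pos hG, Pi.single_eq_same]
    have : (⟨(G : Finset (Fin 20)), hG⟩ : Set.powersetCard (Fin 20) a) = G := rfl
    rw [this, Finsupp.single_eq_same, one_smul]
  · rw [Pi.single_eq_of_ne hF]
    split_ifs with h
    · rw [Finsupp.single_eq_of_ne, zero_smul]
      intro h2
      apply hF
      rw [← h2]
    · rfl

theorem exists_expand {a b : ℕ} (z : (⋀[K]^a (S K 3 3)) ⊗[K] (S K 3 b)) :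
    ∃ w : Set.powersetCard (Fin 20) a → S K 3 b, z = ∑ G, EB K a G ⊗ₜ[K] w G := by
  induction z using TensorProduct.induction_on with
  | zero => exact ⟨0, by simp⟩
  | tmul x w =>
    refine ⟨fun G => (EB K a).repr x G • w, ?_⟩
    conv_lhs => rw [← (EB K a).sum_repr x]
    rw [TensorProduct.sum_tmul]
    refine Finset.sum_congr rfl fun G _ => ?_
    rw [TensorProduct.smul_tmul]
  | add x y hx hy =>
    obtain ⟨w, rfl⟩ := hx
    obtain ⟨w', rfl⟩ := hy
    refine ⟨w + w', ?_⟩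
    rw [← Finset.sum_add_distrib]
    refine Finset.sum_congr rfl fun G _ => ?_
    rw [Pi.add_apply, TensorProduct.tmul_add]

theorem Phi_expand {a b : ℕ} (w : Set.powersetCard (Fin 20) a → S K 3 b) (F : Finset (Fin 20)) :
    Phi K a b (∑ G, EB K a G ⊗ₜ[K] w G) F =
      if h : F.card = a then (w ⟨F, h⟩ : MvPolynomial (Fin 4) K) else 0 := by
  rw [map_sum, Finset.sum_apply]
  simp only [Phi_basis]
  split_ifs with h
  · rw [Finset.sum_eq_single (⟨F, h⟩ : Set.powersetCard (Fin 20) a)]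
    · exact Pi.single_eq_same _ _
    · intro G _ hG
      apply Pi.single_eq_of_ne
      intro h2
      apply hG
      exact Subtype.ext h2.symm
    · simp
  · refine Finset.sum_eq_zero fun G _ => ?_
    apply Pi.single_eq_of_ne
    intro h2
    apply h
    rw [h2]
    exact G.2

theorem Phi_inj {a b : ℕ} {z z' : (⋀[K]^a (S K 3 3)) ⊗[K] (S K 3 b)}
    (h : Phi K a b z = Phi K a b z') : z = z' := by
  obtain ⟨w, rfl⟩ := exists_expand K z
  obtain ⟨w', rfl⟩ := exists_expand K z'
  have : w = w' := by
    funext G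
    have h1 := congrFun h (G : Finset (Fin 20))
    have hG : (G : Finset (Fin 20)).card = a := G.2
    rw [Phi_expand, Phi_expand, dif_pos hG, dif_pos hG] at h1
    exact Subtype.ext h1
  rw [this]

theorem Phi_supp {a b : ℕ} (z : (⋀[K]^a (S K 3 3)) ⊗[K] (S K 3 b)) (F : Finset (Fin 20))
    (h : Phi K a b z F ≠ 0) : F.card = a := by
  obtain ⟨w, rfl⟩ := exists_expand K z
  rw [Phi_expand] at h
  by_contra hc
  rw [dif_neg hc] at h
  exact h rfl

theorem Phi_homog {a b : ℕ} (z : (⋀[K]^a (S K 3 3)) ⊗[K] (S K 3 b)) (F : Finset (Fin 20)) :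
    (Phi K a b z F).IsHomogeneous b := by
  obtain ⟨w, rfl⟩ := exists_expand K z
  rw [Phi_expand]
  split_ifs with h
  · exact (MvPolynomial.mem_homogeneousSubmodule _ _).1 (w ⟨F, h⟩).2
  · exact MvPolynomial.isHomogeneous_zero _ _ _

theorem Phi_surj {a b : ℕ} (c : Finset (Fin 20) → MvPolynomial (Fin 4) K)
    (hs : ∀ F, c F ≠ 0 → F.card = a) (hh : ∀ F, (c F).IsHomogeneous b) :
    ∃ z, Phi K a b z = c := by
  refine ⟨∑ G : Set.powersetCard (Fin 20) a, EB K a G ⊗ₜ[K] (⟨c G, hh G⟩ : S K 3 b), ?_⟩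
  funext F
  rw [Phi_expand]
  split_ifs with h
  · rfl
  · by_contra h0
    exact h (hs F (Ne.symm h0))

theorem sgn_order {a : ℕ} (G : Finset (Fin 20)) (hG : G.card = a) (j : Fin a) :
    sgn (G.orderEmbOfFin hG j) G = (-1) ^ (j : ℕ) := by
  unfold sgn
  congr 1
  have : G.filter (fun k => k < G.orderEmbOfFin hG j) =
      (Finset.Iio j).map (G.orderEmbOfFin hG).toEmbedding := by
    ext k
    simp only [Finset.mem_filter, Finset.mem_map, Finset.mem_Iio]
    constructor
    · rintro ⟨hk, hlt⟩
      have : k ∈ Set.range (G.orderEmbOfFin hG) := by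
        rw [Finset.range_orderEmbOfFin]; exact hk
      obtain ⟨l, rfl⟩ := this
      exact ⟨l, (G.orderEmbOfFin hG).lt_iff_lt.1 hlt, rfl⟩
    · rintro ⟨l, hl, rfl⟩
      exact ⟨Finset.orderEmbOfFin_mem _ _ _, (G.orderEmbOfFin hG).lt_iff_lt.2 hl⟩
  rw [this, Finset.card_map, Fin.card_Iio]

theorem skipAt_strictMono {a : ℕ} (j : Fin a) : StrictMono (skipAt j) := by
  intro x y h
  have h' : (x : ℕ) < y := h
  rw [Fin.lt_def]
  unfold skipAt
  split_ifs <;> simp only <;> omega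

theorem skipAt_ne {a : ℕ} (j : Fin a) (i : Fin (a - 1)) : skipAt j i ≠ j := by
  intro h
  have h' := congrArg Fin.val h
  unfold skipAt at h'
  split_ifs at h' with h1
  · simp only at h'; omega
  · simp only at h'; omega

theorem card_erase_order {a : ℕ} {G : Finset (Fin 20)} (hG : G.card = a) (j : Fin a) :
    (G.erase (G.orderEmbOfFin hG j)).card = a - 1 := by
  rw [Finset.card_erase_of_mem (Finset.orderEmbOfFin_mem _ _ _), hG]

theorem wedge_order {a : ℕ} (G : Set.powersetCard (Fin 20) a) :
    EB K a G = wedge K a (fun i => BB K ((G : Finset (Fin 20)).orderEmbOfFin G.2 i)) := by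
  rw [exteriorPower.basis_apply]
  rfl

theorem wedge_skip {a : ℕ} (G : Set.powersetCard (Fin 20) a) (j : Fin a) :
    wedge K (a - 1) (fun i => BB K ((G : Finset (Fin 20)).orderEmbOfFin G.2 (skipAt j i))) =
      EB K (a - 1) ⟨(G : Finset (Fin 20)).erase ((G : Finset (Fin 20)).orderEmbOfFin G.2 j),
        card_erase_order G.2 j⟩ := by
  rw [wedge_order]
  congr 1
  funext i
  congr 1
  have h := Finset.orderEmbOfFin_unique (card_erase_order G.2 j)
    (f := fun i => (G : Finset (Fin 20)).orderEmbOfFin G.2 (skipAt j i))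
    (fun i => Finset.mem_erase.2 ⟨fun h => skipAt_ne j i
      (((G : Finset (Fin 20)).orderEmbOfFin G.2).injective h), Finset.orderEmbOfFin_mem _ _ _⟩)
    (((G : Finset (Fin 20)).orderEmbOfFin G.2).strictMono.comp (skipAt_strictMono j))
  exact congrFun h i

theorem Phi_delta {a b : ℕ} {δ : ((⋀[K]^a (S K 3 3)) ⊗[K] (S K 3 b)) →ₗ[K]
         ((⋀[K]^(a - 1) (S K 3 3)) ⊗[K] (S K 3 (b + 3)))} (hδ : IsKoszulMap K 3 3 a b δ)
    (z : (⋀[K]^a (S K 3 3)) ⊗[K] (S K 3 b)) :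
    Phi K (a - 1) (b + 3) (δ z) = D (Phi K a b z) := by
  let DL : (Finset (Fin 20) → MvPolynomial (Fin 4) K) →ₗ[K]
      (Finset (Fin 20) → MvPolynomial (Fin 4) K) :=
    { toFun := D
      map_add' := fun c e => funext fun F => D_add c e F
      map_smul' := fun r c => funext fun F => D_smul r c F }
  change Phi K (a - 1) (b + 3) (δ z) = DL (Phi K a b z)
  obtain ⟨w, rfl⟩ := exists_expand K z
  simp only [map_sum]
  refine Finset.sum_congr rfl fun G _ => ?_
  change _ = D _
  rw [Phi_basis, D_single]
  conv_lhs => rw [wedge_order]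
  rw [hδ, map_sum]
  have hsum := Finset.sum_map Finset.univ
    ((G : Finset (Fin 20)).orderEmbOfFin G.2).toEmbedding
    (fun j => sgn j (G : Finset (Fin 20)) •
      (Pi.single ((G : Finset (Fin 20)).erase j) (uu K j * (w G : MvPolynomial (Fin 4) K)) :
        Finset (Fin 20) → MvPolynomial (Fin 4) K))
  have hmap : Finset.map ((G : Finset (Fin 20)).orderEmbOfFin G.2).toEmbedding Finset.univ =
      (G : Finset (Fin 20)) := Finset.map_orderEmbOfFin_univ _ G.2
  rw [hmap] at hsum
  rw [hsum]
  refine Finset.sum_congr rfl fun j _ => ?_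
  rw [map_smul, wedge_skip, Phi_basis]
  change _ = sgn ((G : Finset (Fin 20)).orderEmbOfFin G.2 j) (G : Finset (Fin 20)) • _
  have hs : sgn ((G : Finset (Fin 20)).orderEmbOfFin G.2 j) (G : Finset (Fin 20)) =
      (-1) ^ (j : ℕ) := sgn_order _ G.2 j
  rw [hs]
  have h1 : ((mulSW K (BB K ((G : Finset (Fin 20)).orderEmbOfFin G.2 j)) (w G) : S K 3 (b + 3)) :
      MvPolynomial (Fin 4) K) = uu K ((G : Finset (Fin 20)).orderEmbOfFin G.2 j) * w G := by
    rw [BB_apply]; rfl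
  rw [h1, ← Int.cast_smul_eq_zsmul K]
  push_cast
  rfl

theorem Phi_cast {a b b' : ℕ} (h : b = b') (z : (⋀[K]^a (S K 3 3)) ⊗[K] (S K 3 b)) :
    Phi K a b' ((TensorProduct.congr (LinearEquiv.refl K (⋀[K]^a (S K 3 3)))
      (scast K h)) z) = Phi K a b z := by
  obtain ⟨w, rfl⟩ := exists_expand K z
  rw [map_sum, map_sum, map_sum]
  refine Finset.sum_congr rfl fun G _ => ?_
  rw [TensorProduct.congr_tmul, LinearEquiv.refl_apply, Phi_basis, Phi_basis]
  rfl

theorem exact_final [CharZero K] {i q : ℕ} (hi : i ≤ 6) (hq : 2 ≤ q) :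
    VKExact K 3 3 i q := by
  intro h δ₁ δ₂ h₁ h₂
  ext z
  rw [LinearMap.mem_ker, LinearMap.mem_range]
  constructor
  · intro hz
    have hD := Phi_delta K h₁ z
    rw [hz, map_zero] at hD
    obtain ⟨e, he1, he2, he3⟩ := exact_model (K := K) hi hq (Phi K i (q * 3) z)
      (fun F hF => ⟨fun _ _ => Nat.zero_le _, Phi_supp K z F hF⟩) (Phi_homog K z)
      (fun F => by rw [← hD]; exact Submodule.zero_mem _)
    obtain ⟨y, hy⟩ := Phi_surj K (a := i + 1) (b := (q - 1) * 3) e (fun F hF => (he1 F hF).2)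
      (fun F => by
        rw [show (q - 1) * 3 = q * 3 - 3 by omega]
        exact he2 F)
    refine ⟨y, ?_⟩
    apply Phi_inj K
    rw [LinearMap.comp_apply, LinearEquiv.coe_coe, Phi_cast]
    have hDy := Phi_delta K h₂ y
    rw [hy] at hDy
    refine hDy.trans ?_
    funext F
    have h0 : Phi K i (q * 3) z F - D e F = 0 := by
      refine MvPolynomial.ext _ _ fun m => ?_
      rw [he3 F m (fun l hl => absurd hl (Nat.not_lt_zero _))]
      simp
    exact (sub_eq_zero.1 h0).symm
  · rintro ⟨y, rfl⟩
    apply Phi_inj K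
    rw [Phi_delta K h₁, LinearMap.comp_apply, LinearEquiv.coe_coe, Phi_cast, map_zero]
    have hDy := Phi_delta K h₂ y
    have hDy' : Phi K i ((q - 1) * 3 + 3) (δ₂ y) = D (Phi K (i + 1) ((q - 1) * 3) y) := hDy
    rw [hDy']
    funext F
    exact D_D _ F

end transfer

end

end VK

/-- for `n = 3`, `d = 3`, the Veronese–Koszul complex at `(i,q)` is exact for all
`1 ≤ i ≤ 6` and `q ≥ 2` (the cubic Veronese embedding of `P^3` satisfies `N_6`). -/
theorem stmt12 (K : Type*) [Field K] [CharZero K] :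
    ∀ i, 1 ≤ i → i ≤ 6 → ∀ q, 2 ≤ q → VKExact K 3 3 i q := by
  intro i _ hi q hq
  exact VK.exact_final K hi hq
end

section
/- Suppose n = 3 and d = 3. Then there exists an integer q ≥ 2 such that the Veronese–Koszul complex at (7, q) is not exact. (Together with exactness for all 1 ≤ i ≤ 6 and q ≥ 2, this shows that the cubic Veronese embedding φ_{O(3)} : P^3 ↪ P^{19} satisfies property N_p exactly for p ≤ 6 = 3d−3, confirming the paper's conjecture in the case n = d = 3.) -/
open TensorProduct

noncomputable section VKProof

namespace VKProof

section Generic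
variable {K : Type*} [Field K] {V W W' T : Type*} [AddCommGroup V] [Module K V] [AddCommGroup W]
  [Module K W] [AddCommGroup W'] [Module K W'] [AddCommGroup T] [Module K T]

/-- The bilinear data for the Koszul map. -/
def gAux (a : ℕ) (μ : V →ₗ[K] W →ₗ[K] W') (β : (⋀[K]^a V) →ₗ[K] W' →ₗ[K] T) :
    V →ₗ[K] V [⋀^Fin a]→ₗ[K] (W →ₗ[K] T) where
  toFun s := ((LinearMap.llcomp K _ _ _ |>.flip (μ s)) ∘ₗ β).compAlternatingMap
      (exteriorPower.ιMulti K a)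
  map_add' x y := by
    ext v w
    simp
  map_smul' c x := by
    ext v w
    simp

/-- The Koszul map. -/
def gKos (a : ℕ) (μ : V →ₗ[K] W →ₗ[K] W') (β : (⋀[K]^a V) →ₗ[K] W' →ₗ[K] T) :
    ((⋀[K]^(a + 1) V) ⊗[K] W) →ₗ[K] T :=
  TensorProduct.lift (exteriorPower.alternatingMapLinearEquiv
    (AlternatingMap.alternatizeUncurryFin (gAux a μ β)))

lemma gKos_apply (a : ℕ) (μ : V →ₗ[K] W →ₗ[K] W') (β : (⋀[K]^a V) →ₗ[K] W' →ₗ[K] T)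
    (s : Fin (a + 1) → V) (w : W) :
    gKos a μ β (wedge K (a + 1) s ⊗ₜ[K] w) = ∑ j : Fin (a + 1), ((-1 : K) ^ (j : ℕ)) •
        β (wedge K a (j.removeNth s)) (μ (s j) w) := by
  have h : wedge K (a + 1) s = exteriorPower.ιMulti K (a + 1) s := rfl
  rw [h, gKos, TensorProduct.lift.tmul, exteriorPower.alternatingMapLinearEquiv_apply_ιMulti,
    AlternatingMap.alternatizeUncurryFin_apply, LinearMap.sum_apply]
  refine Finset.sum_congr rfl fun j _ => ?_
  have h3 : gAux a μ β (s j) (j.removeNth s) w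
    = β (wedge K a (j.removeNth s)) (μ (s j) w) := rfl
  rw [LinearMap.smul_apply, h3]
  rcases neg_one_pow_eq_or ℤ (j : ℕ) with h4 | h4
  · have h5 : ((-1 : K) ^ (j : ℕ)) = 1 := by exact_mod_cast congrArg (Int.cast : ℤ → K) h4
    rw [h4, h5, one_smul, one_smul]
  · have h5 : ((-1 : K) ^ (j : ℕ)) = -1 := by exact_mod_cast congrArg (Int.cast : ℤ → K) h4
    rw [h4, h5, neg_smul, neg_smul, one_smul, one_smul]

lemma exists_kos {U : Type*} [AddCommMonoid U] [Module K U] (a : ℕ) (μ : V →ₗ[K] W →ₗ[K] W')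
    (β : (⋀[K]^a V) →ₗ[K] W' →ₗ[K] U) :
    ∃ δ : ((⋀[K]^(a + 1) V) ⊗[K] W) →ₗ[K] U, ∀ (s : Fin (a + 1) → V) (w : W),
      δ (wedge K (a + 1) s ⊗ₜ[K] w) = ∑ j : Fin (a + 1), ((-1 : K) ^ (j : ℕ)) •
        β (wedge K a (j.removeNth s)) (μ (s j) w) := by
  let _ : AddCommGroup U := Module.addCommMonoidToAddCommGroup K
  exact ⟨gKos a μ β, gKos_apply a μ β⟩

end Generic

variable (K : Type*) [Field K]

/-- Multiplication as a bilinear map. -/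
def mulL (n d b : ℕ) : S K n d →ₗ[K] S K n b →ₗ[K] S K n (b + d) :=
  LinearMap.mk₂ K (fun s w => mulSW K s w)
    (fun _ _ _ => Subtype.ext (by simp [mulSW, add_mul]))
    (fun _ _ _ => Subtype.ext (by simp [mulSW]))
    (fun _ _ _ => Subtype.ext (by simp [mulSW, mul_add]))
    (fun _ _ _ => Subtype.ext (by simp [mulSW]))

lemma skipAt_eq {a : ℕ} (j : Fin (a + 1)) (i : Fin a) :
    skipAt (a := a + 1) j i = j.succAbove i := by
  unfold skipAt
  ext
  by_cases h : (i : ℕ) < (j : ℕ)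
  · rw [if_pos h, Fin.succAbove_of_castSucc_lt _ _ (by simpa [Fin.lt_def] using h)]
    simp
  · rw [if_neg h, Fin.succAbove_of_le_castSucc _ _ (by simpa [Fin.le_def] using h)]
    simp

lemma exists_isKoszulMap (n d a b : ℕ) : ∃ δ, IsKoszulMap K n d (a + 1) b δ := by
  obtain ⟨δ, h⟩ := exists_kos a (mulL K n d b)
    (TensorProduct.mk K (⋀[K]^a (S K n d)) (S K n (b + d)))
  refine ⟨δ, fun s w => ?_⟩
  refine (h s w).trans ?_
  refine Finset.sum_congr rfl fun j _ => ?_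
  have h2 : (fun i => s (skipAt j i)) = j.removeNth s := by
    funext i
    exact congrArg s (skipAt_eq j i)
  have h3 : wedge K (a + 1 - 1) (fun i => s (skipAt j i)) = wedge K a (j.removeNth s) :=
    congrArg (wedge K a) h2
  rw [h3]
  rfl


/-- The exponents of the ten cubic monomials in `x_0, x_1, x_2`; the last three are cubes. -/
def ex : Fin 7 ⊕ Fin 3 → Fin 4 → ℕ
  | Sum.inl k => (![![2,1,0,0], ![2,0,1,0], ![1,2,0,0], ![0,2,1,0], ![1,0,2,0], ![0,1,2,0],
      ![1,1,1,0]] : Fin 7 → Fin 4 → ℕ) k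
  | Sum.inr k => (![![3,0,0,0], ![0,3,0,0], ![0,0,3,0]] : Fin 3 → Fin 4 → ℕ) k

lemma ex_inj : Function.Injective ex := by
  intro a b; revert a b; decide

/-- The exponents as finitely supported functions. -/
def exs (k : Fin 7 ⊕ Fin 3) : Fin 4 →₀ ℕ := Finsupp.equivFunOnFinite.symm (ex k)

lemma exs_inj : Function.Injective exs :=
  Finsupp.equivFunOnFinite.symm.injective.comp ex_inj

lemma ex_sum (k) : ∑ i, ex k i = 3 := by revert k; decide

lemma ex_three (k) : ex k 3 = 0 := by revert k; decide

lemma exs_degree (k) : (exs k).degree = 3 := by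
  rw [Finsupp.degree_eq_sum]; exact ex_sum k

/-- The ten monomials. -/
def e (k : Fin 7 ⊕ Fin 3) : S K 3 3 :=
  ⟨MvPolynomial.monomial (exs k) 1, MvPolynomial.isHomogeneous_monomial _ (exs_degree k)⟩

/-- The Jacobian determinant. -/
def jac (a b c : S K 3 3) : S K 3 (2 * 3) :=
  ⟨Matrix.det (Matrix.of fun i j : Fin 3 =>
      MvPolynomial.pderiv (Fin.castSucc j)
        ((![a, b, c] i : S K 3 3) : MvPolynomial (Fin 4) K)), by
    have hh : ∀ (j : Fin 4) (a : S K 3 3),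
        (MvPolynomial.pderiv j (a : MvPolynomial (Fin 4) K)).IsHomogeneous 2 := fun j a =>
      MvPolynomial.IsHomogeneous.pderiv (n := 3) ((MvPolynomial.mem_homogeneousSubmodule _ _).1 a.2)
    have h3 : ∀ (i j k : Fin 4) (a b c : S K 3 3), (MvPolynomial.pderiv i (a : MvPolynomial (Fin 4) K)
       * MvPolynomial.pderiv j (b : MvPolynomial (Fin 4) K) *
       MvPolynomial.pderiv k (c : MvPolynomial (Fin 4) K)) ∈ S K 3 (2 * 3) := fun i j k a b c =>
      (MvPolynomial.mem_homogeneousSubmodule _ _).2 (((hh i a).mul (hh j b)).mul (hh k c))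
    rw [Matrix.det_fin_three]
    refine Submodule.sub_mem _ (Submodule.add_mem _ (Submodule.add_mem _ (Submodule.sub_mem _
      (Submodule.sub_mem _ ?_ ?_) ?_) ?_) ?_) ?_ <;> exact h3 _ _ _ _ _ _⟩

lemma jac_coe (a b c : S K 3 3) : (jac K a b c : MvPolynomial (Fin 4) K) =
    Matrix.det (Matrix.of fun i j : Fin 3 => MvPolynomial.pderiv (Fin.castSucc j)
        ((![a, b, c] i : S K 3 3) : MvPolynomial (Fin 4) K)) := rfl

lemma euler (k) : (3 : MvPolynomial (Fin 4) K) * (e K k : MvPolynomial (Fin 4) K) =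
    MvPolynomial.X 0 * MvPolynomial.pderiv 0 (e K k : MvPolynomial (Fin 4) K) +
    MvPolynomial.X 1 * MvPolynomial.pderiv 1 (e K k : MvPolynomial (Fin 4) K) +
    MvPolynomial.X 2 * MvPolynomial.pderiv 2 (e K k : MvPolynomial (Fin 4) K) := by
  have h := MvPolynomial.IsHomogeneous.sum_X_mul_pderiv
    ((MvPolynomial.mem_homogeneousSubmodule _ _).1 (e K k).2)
  have h0 : MvPolynomial.pderiv 3 (e K k : MvPolynomial (Fin 4) K) = 0 := by
    have : exs k 3 = 0 := ex_three k
    simp [e, MvPolynomial.pderiv_monomial, this]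
  have h' : ∑ i : Fin 4, MvPolynomial.X i * MvPolynomial.pderiv i (e K k : MvPolynomial (Fin 4) K)
    = 3 • (e K k : MvPolynomial (Fin 4) K) := h
  rw [Fin.sum_univ_four, h0, mul_zero, add_zero] at h'
  rw [h']
  simp

lemma jac_rel [CharZero K] (p q r s) : (mulSW K (e K p) (jac K (e K q) (e K r) (e K s))) =
    mulSW K (e K q) (jac K (e K p) (e K r) (e K s)) +
    mulSW K (e K r) (jac K (e K q) (e K p) (e K s)) +
    mulSW K (e K s) (jac K (e K q) (e K r) (e K p)) := by
  apply Subtype.ext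
  have h3 : (3 : MvPolynomial (Fin 4) K) ≠ 0 := by
    exact_mod_cast (by norm_num : (3:ℕ) ≠ 0)
  apply mul_left_cancel₀ h3
  have hp := euler K p
  have hq := euler K q
  have hr := euler K r
  have hs := euler K s
  simp only [mulSW, Submodule.coe_add, jac_coe, mul_add, ← mul_assoc, hp, hq, hr, hs]
  simp only [Matrix.det_fin_three, Matrix.of_apply, Matrix.cons_val]
  simp only [show Fin.castSucc (0 : Fin 3) = (0 : Fin 4) from rfl,
    show Fin.castSucc (1 : Fin 3) = (1 : Fin 4) from rfl,
    show Fin.castSucc (2 : Fin 3) = (2 : Fin 4) from rfl]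
  ring

/-- The Koszul cycle. -/
def cyc : (⋀[K]^7 (S K 3 3)) ⊗[K] (S K 3 (2 * 3)) :=
  ∑ σ : Equiv.Perm (Fin 7 ⊕ Fin 3), (Equiv.Perm.sign σ : ℤ) •
    (wedge K 7 (fun i => e K (σ (Sum.inl i))) ⊗ₜ[K]
      jac K (e K (σ (Sum.inr 0))) (e K (σ (Sum.inr 1))) (e K (σ (Sum.inr 2))))

lemma swap_sum {A : Type*} [AddCommGroup A] (F : Equiv.Perm (Fin 7 ⊕ Fin 3) → A) (j : Fin 7)
    (k : Fin 3) : ∑ σ : Equiv.Perm (Fin 7 ⊕ Fin 3), (Equiv.Perm.sign σ : ℤ) •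
      F (σ * Equiv.swap (Sum.inl j) (Sum.inr k)) =
      - ∑ σ : Equiv.Perm (Fin 7 ⊕ Fin 3), (Equiv.Perm.sign σ : ℤ) • F σ := by
  rw [← Equiv.sum_comp (Equiv.mulRight (Equiv.swap (Sum.inl j) (Sum.inr k))), ← Finset.sum_neg_distrib]
  refine Finset.sum_congr rfl fun σ _ => ?_
  simp [mul_assoc]

lemma cyc_term [CharZero K] (j : Fin 7) : ∑ σ : Equiv.Perm (Fin 7 ⊕ Fin 3), (Equiv.Perm.sign σ : ℤ) •
    ((wedge K 6 (fun i => e K (σ (Sum.inl (skipAt j i))))) ⊗ₜ[K]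
      mulSW K (e K (σ (Sum.inl j)))
      (jac K (e K (σ (Sum.inr 0))) (e K (σ (Sum.inr 1))) (e K (σ (Sum.inr 2))))) = 0 := by
  set F : Equiv.Perm (Fin 7 ⊕ Fin 3) → (⋀[K]^6 (S K 3 3)) ⊗[K] (S K 3 (2 * 3 + 3)) := fun σ =>
    ((wedge K 6 (fun i => e K (σ (Sum.inl (skipAt j i))))) ⊗ₜ[K]
      mulSW K (e K (σ (Sum.inl j)))
      (jac K (e K (σ (Sum.inr 0))) (e K (σ (Sum.inr 1))) (e K (σ (Sum.inr 2))))) with hF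
  change ∑ σ : Equiv.Perm (Fin 7 ⊕ Fin 3), (Equiv.Perm.sign σ : ℤ) • F σ = 0
  have key : ∀ σ, F σ = F (σ * Equiv.swap (Sum.inl j) (Sum.inr 0)) +
      F (σ * Equiv.swap (Sum.inl j) (Sum.inr 1)) + F (σ * Equiv.swap (Sum.inl j) (Sum.inr 2)) := by
    intro σ
    have hs : ∀ i (k : Fin 3), Equiv.swap (Sum.inl j : Fin 7 ⊕ Fin 3) (Sum.inr k)
        (Sum.inl (skipAt j i)) = Sum.inl (skipAt j i) := by
      intro i k
      apply Equiv.swap_apply_of_ne_of_ne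
      · intro h
        have h2 := Sum.inl_injective h
        rw [skipAt_eq (a := 6)] at h2
        exact Fin.succAbove_ne j i h2
      · simp
    have hr : ∀ k l : Fin 3, l ≠ k → Equiv.swap (Sum.inl j : Fin 7 ⊕ Fin 3) (Sum.inr k)
        (Sum.inr l) = Sum.inr l := by
      intro k l h
      apply Equiv.swap_apply_of_ne_of_ne
      · simp
      · simpa using h
    simp only [hF, Equiv.Perm.mul_apply, hs, Equiv.swap_apply_left, Equiv.swap_apply_right]
    rw [hr 0 1 (by decide), hr 0 2 (by decide), hr 1 0 (by decide), hr 1 2 (by decide),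
      hr 2 0 (by decide), hr 2 1 (by decide), jac_rel, TensorProduct.tmul_add, TensorProduct.tmul_add]
  have h := Finset.sum_congr (rfl : (Finset.univ : Finset (Equiv.Perm (Fin 7 ⊕ Fin 3))) = _)
    (fun σ _ => congrArg (fun t => (Equiv.Perm.sign σ : ℤ) • t) (key σ))
  simp only [smul_add, Finset.sum_add_distrib, swap_sum F] at h
  set D := ∑ σ : Equiv.Perm (Fin 7 ⊕ Fin 3), (Equiv.Perm.sign σ : ℤ) • F σ with hD
  have h4 : (4 : K) • D = 0 := by
    have : (4 : K) • D = D + D + D + D := by module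
    rw [this]
    nth_rewrite 1 [h]
    abel
  exact (smul_eq_zero.1 h4).resolve_left (by norm_num)

lemma cyc_mem [CharZero K] (δ : ((⋀[K]^7 (S K 3 3)) ⊗[K] (S K 3 (2 * 3))) →ₗ[K]
         ((⋀[K]^(7 - 1) (S K 3 3)) ⊗[K] (S K 3 (2 * 3 + 3))))
    (h : IsKoszulMap K 3 3 7 (2 * 3) δ) : δ (cyc K) = 0 := by
  rw [cyc, map_sum]
  simp only [map_zsmul, h _ _, Finset.smul_sum]
  rw [Finset.sum_comm]
  refine Finset.sum_eq_zero fun j _ => ?_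
  simp only [smul_comm _ ((-1 : K) ^ (j : ℕ)), ← Finset.smul_sum]
  exact smul_eq_zero_of_right _ (cyc_term K j)

/-- The exponent `(2,2,2,0)`. -/
def u : Fin 4 →₀ ℕ := Finsupp.equivFunOnFinite.symm ![2, 2, 2, 0]

/-- The seven coefficients. -/
def L : S K 3 3 →ₗ[K] (Fin 7 → K) :=
  LinearMap.pi fun k => (MvPolynomial.lcoeff K (exs (Sum.inl k))) ∘ₗ (S K 3 3).subtype

lemma L_apply (s : S K 3 3) (k : Fin 7) :
    L K s k = MvPolynomial.coeff (exs (Sum.inl k)) (s : MvPolynomial (Fin 4) K) := rfl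

/-- The functional on `S_6`. -/
def cu : S K 3 (2 * 3) →ₗ[K] K := (MvPolynomial.lcoeff K u) ∘ₗ (S K 3 (2 * 3)).subtype

lemma cu_apply (w : S K 3 (2 * 3)) :
    cu K w = MvPolynomial.coeff u (w : MvPolynomial (Fin 4) K) := rfl

/-- The functional detecting the cycle. -/
def phi : ((⋀[K]^7 (S K 3 3)) ⊗[K] (S K 3 (2 * 3))) →ₗ[K] K :=
  LinearMap.mul' K K ∘ₗ TensorProduct.map
    (exteriorPower.alternatingMapLinearEquiv (R := K) (M := S K 3 3) (N := K)
      ((Matrix.detRowAlternating (R := K) (n := Fin 7)).compLinearMap (L K))) (cu K)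

lemma det_of (n : ℕ) (f : Fin n → Fin n → K) :
    (Matrix.detRowAlternating (R := K) (n := Fin n)) f = Matrix.det (Matrix.of f) := rfl

lemma phi_apply (v : Fin 7 → S K 3 3) (w : S K 3 (2 * 3)) :
    phi K (wedge K 7 v ⊗ₜ[K] w) = Matrix.det (Matrix.of fun i => L K (v i)) * cu K w := by
  have h : wedge K 7 v = exteriorPower.ιMulti K 7 v := rfl
  rw [h, phi, LinearMap.comp_apply, TensorProduct.map_tmul,
    exteriorPower.alternatingMapLinearEquiv_apply_ιMulti, LinearMap.mul'_apply,
    AlternatingMap.compLinearMap_apply, det_of]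

lemma exists_ex (f : Fin 4 → ℕ) (h0 : f 0 ≤ 2) (h1 : f 1 ≤ 2) (h2 : f 2 ≤ 2) (h3 : f 3 = 0)
    (hs : f 0 + f 1 + f 2 + f 3 = 3) : ∃ k : Fin 7, ex (Sum.inl k) = f := by
  have key : ∀ a b c : Fin 3, (a : ℕ) + b + c = 3 →
      ∃ k : Fin 7, ex (Sum.inl k) = ![(a : ℕ), b, c, 0] := by decide
  obtain ⟨k, hk⟩ := key ⟨f 0, by omega⟩ ⟨f 1, by omega⟩ ⟨f 2, by omega⟩ (by simp; omega)
  refine ⟨k, hk.trans ?_⟩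
  funext i
  fin_cases i <;> simp [h3]

lemma ex_le (k : Fin 7) : exs (Sum.inl k) ≤ u := by
  have : ∀ k : Fin 7, ∀ i : Fin 4, ex (Sum.inl k) i ≤ (![2, 2, 2, 0] : Fin 4 → ℕ) i := by decide
  exact fun i => this k i

lemma coeff_prod (s : S K 3 3) (w : MvPolynomial (Fin 4) K) :
    MvPolynomial.coeff u ((s : MvPolynomial (Fin 4) K) * w) =
      ∑ k : Fin 7, L K s k * MvPolynomial.coeff (u - exs (Sum.inl k)) w := by
  rw [MvPolynomial.coeff_mul]
  symm
  have hinj : Function.Injective (fun k : Fin 7 => (exs (Sum.inl k), u - exs (Sum.inl k))) := by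
    intro a b h
    exact Sum.inl_injective (exs_inj (Prod.ext_iff.1 h).1)
  have h1 : ∑ k : Fin 7, L K s k * MvPolynomial.coeff (u - exs (Sum.inl k)) w =
      ∑ p ∈ Finset.univ.map ⟨_, hinj⟩, MvPolynomial.coeff p.1 (s : MvPolynomial (Fin 4) K) *
        MvPolynomial.coeff p.2 w := by
    rw [Finset.sum_map]; rfl
  rw [h1]
  apply Finset.sum_subset
  · intro p hp
    obtain ⟨k, -, rfl⟩ := Finset.mem_map.1 hp
    rw [Finset.HasAntidiagonal.mem_antidiagonal]
    exact add_tsub_cancel_of_le (ex_le k)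
  · intro p hp hn
    rw [Finset.HasAntidiagonal.mem_antidiagonal] at hp
    by_contra hne
    apply hn
    have hc := left_ne_zero_of_mul hne
    have hd : p.1.degree = 3 := by
      by_contra hd
      exact hc (((MvPolynomial.mem_homogeneousSubmodule _ _).1 s.2).coeff_eq_zero hd)
    rw [Finsupp.degree_eq_sum] at hd
    have hd' : p.1 0 + p.1 1 + p.1 2 + p.1 3 = 3 := by
      exact (Fin.sum_univ_four (fun i => p.1 i)).symm.trans hd
    have hi : ∀ i, p.1 i ≤ (![2, 2, 2, 0] : Fin 4 → ℕ) i := by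
      intro i
      have h2 := DFunLike.congr_fun hp i
      have h3 : u i = (![2, 2, 2, 0] : Fin 4 → ℕ) i := rfl
      rw [Finsupp.add_apply] at h2
      omega
    obtain ⟨k, hk⟩ := exists_ex p.1 (hi 0) (hi 1) (hi 2) (Nat.le_zero.1 (hi 3)) hd'
    have hk' : exs (Sum.inl k) = p.1 := by
      apply DFunLike.coe_injective; exact hk
    rw [Finset.mem_map]
    refine ⟨k, Finset.mem_univ _, ?_⟩
    have : p.2 = u - p.1 := by rw [← hp, add_tsub_cancel_left]
    exact Prod.ext hk' (by rw [this, ← hk']; rfl)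

lemma laplace (l : (Fin 7 → K) →ₗ[K] K) (v : Fin 8 → Fin 7 → K) :
    ∑ j : Fin 8, (-1 : K) ^ (j : ℕ) * (Matrix.det (Matrix.of fun i => v (j.succAbove i)) * l (v j))
      = 0 := by
  have h := (AlternatingMap.alternatizeUncurryFin
    (l.smulRight (Matrix.detRowAlternating (R := K) (n := Fin 7)))).map_linearDependent (K := K) v
    (by
      intro hv
      have := hv.fintype_card_le_finrank
      simp at this)
  rw [AlternatingMap.alternatizeUncurryFin_apply] at h
  rw [← h]
  refine Finset.sum_congr rfl fun j _ => ?_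
  have h3 : (l.smulRight (Matrix.detRowAlternating (R := K) (n := Fin 7))) (v j) (j.removeNth v)
    = l (v j) * Matrix.det (Matrix.of fun i => v (j.succAbove i)) := by
    rw [LinearMap.smulRight_apply, AlternatingMap.smul_apply, smul_eq_mul, det_of]
    rfl
  rw [h3, zsmul_eq_mul, mul_comm (l (v j))]
  push_cast
  rfl

lemma phi_bdry (h : (2 - 1) * 3 + 3 = 2 * 3)
    (δ : ((⋀[K]^(7 + 1) (S K 3 3)) ⊗[K] (S K 3 ((2 - 1) * 3))) →ₗ[K]
          ((⋀[K]^7 (S K 3 3)) ⊗[K] (S K 3 ((2 - 1) * 3 + 3))))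
    (hδ : IsKoszulMap K 3 3 (7 + 1) ((2 - 1) * 3) δ) :
    phi K ∘ₗ ((TensorProduct.congr (LinearEquiv.refl K (⋀[K]^7 (S K 3 3)))
            (scast K h)).toLinearMap ∘ₗ δ) = 0 := by
  apply TensorProduct.ext
  apply exteriorPower.linearMap_ext
  ext v w
  change phi K ((TensorProduct.congr (LinearEquiv.refl K (⋀[K]^7 (S K 3 3)))
            (scast K h)) (δ (wedge K 8 v ⊗ₜ[K] w))) = 0
  rw [hδ v w, map_sum, map_sum]
  set l : (Fin 7 → K) →ₗ[K] K := ∑ k : Fin 7,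
    (MvPolynomial.coeff (u - exs (Sum.inl k)) (w : MvPolynomial (Fin 4) K)) • LinearMap.proj k with hl
  rw [← laplace K l (fun j => L K (v j))]
  refine Finset.sum_congr rfl fun j _ => ?_
  rw [map_smul, map_smul, TensorProduct.congr_tmul, smul_eq_mul]
  congr 1
  refine (phi_apply K (fun i => v (skipAt j i)) _).trans ?_
  refine congrArg₂ (fun x y : K => x * y) ?_ ?_
  · have h2 : (fun i : Fin 7 => v (skipAt (a := 8) j i)) = fun i => v (j.succAbove i) := by
      funext i
      exact congrArg v (skipAt_eq j i)
    exact congrArg (fun f : Fin 7 → S K 3 3 => Matrix.det (Matrix.of fun i => L K (f i))) h2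
  · refine (coeff_prod K (v j) w).trans ?_
    simp [hl, mul_comm]

lemma L_e (a : Fin 7 ⊕ Fin 3) (k : Fin 7) : L K (e K a) k = if a = Sum.inl k then 1 else 0 := by
  rw [L_apply, e]
  simp only [MvPolynomial.coeff_monomial, exs_inj.eq_iff]

lemma jac_cubes : cu K (jac K (e K (Sum.inr 0)) (e K (Sum.inr 1)) (e K (Sum.inr 2))) = 27 := by
  have h0 : (e K (Sum.inr 0) : MvPolynomial (Fin 4) K) = MvPolynomial.X 0 ^ 3 := by
    rw [MvPolynomial.X_pow_eq_monomial, e]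
    refine congrArg (fun m => MvPolynomial.monomial m (1 : K)) (Finsupp.ext fun i => ?_)
    fin_cases i <;> simp [exs, ex]
  have h1 : (e K (Sum.inr 1) : MvPolynomial (Fin 4) K) = MvPolynomial.X 1 ^ 3 := by
    rw [MvPolynomial.X_pow_eq_monomial, e]
    refine congrArg (fun m => MvPolynomial.monomial m (1 : K)) (Finsupp.ext fun i => ?_)
    fin_cases i <;> simp [exs, ex]
  have h2 : (e K (Sum.inr 2) : MvPolynomial (Fin 4) K) = MvPolynomial.X 2 ^ 3 := by
    rw [MvPolynomial.X_pow_eq_monomial, e]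
    refine congrArg (fun m => MvPolynomial.monomial m (1 : K)) (Finsupp.ext fun i => ?_)
    fin_cases i <;> simp [exs, ex]
  have hj : (jac K (e K (Sum.inr 0)) (e K (Sum.inr 1)) (e K (Sum.inr 2)) : MvPolynomial (Fin 4) K)
      = MvPolynomial.monomial u 27 := by
    have hu : MvPolynomial.monomial u (27 : K) =
        MvPolynomial.C 27 * (MvPolynomial.X 0 ^ 2 * MvPolynomial.X 1 ^ 2 * MvPolynomial.X 2 ^ 2) := by
      rw [MvPolynomial.monomial_eq, Finsupp.prod_fintype _ _ (by simp), Fin.prod_univ_four]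
      simp [u]
    rw [hu, jac_coe, Matrix.det_fin_three]
    simp only [Matrix.of_apply, Matrix.cons_val, h0, h1, h2,
      show Fin.castSucc (0 : Fin 3) = (0 : Fin 4) from rfl,
      show Fin.castSucc (1 : Fin 3) = (1 : Fin 4) from rfl,
      show Fin.castSucc (2 : Fin 3) = (2 : Fin 4) from rfl]
    have h27 : (MvPolynomial.C (27 : K) : MvPolynomial (Fin 4) K) = 27 :=
      map_ofNat MvPolynomial.C 27
    rw [h27]
    simp [MvPolynomial.pderiv_X, Derivation.leibniz_pow]
    ring
  rw [cu_apply, hj, MvPolynomial.coeff_monomial, if_pos rfl]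

lemma jac_perm (τ : Equiv.Perm (Fin 3)) :
    cu K (jac K (e K (Sum.inr (τ 0))) (e K (Sum.inr (τ 1))) (e K (Sum.inr (τ 2)))) =
      ((Equiv.Perm.sign τ : ℤ) : K) * 27 := by
  rw [← jac_cubes K]
  have h : (jac K (e K (Sum.inr (τ 0))) (e K (Sum.inr (τ 1))) (e K (Sum.inr (τ 2)))) =
      (Equiv.Perm.sign τ : ℤ) • jac K (e K (Sum.inr 0)) (e K (Sum.inr 1)) (e K (Sum.inr 2)) := by
    apply Subtype.ext
    rw [Submodule.coe_smul_of_tower, jac_coe, jac_coe, zsmul_eq_mul, ← Matrix.det_permute]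
    congr 1
    have h1 : ∀ i : Fin 3, (![e K (Sum.inr (τ 0)), e K (Sum.inr (τ 1)), e K (Sum.inr (τ 2))] i) =
        e K (Sum.inr (τ i)) := by
      intro i; fin_cases i <;> rfl
    have h2 : ∀ i : Fin 3, (![e K (Sum.inr 0), e K (Sum.inr 1), e K (Sum.inr 2)] i) =
        e K (Sum.inr i) := by
      intro i; fin_cases i <;> rfl
    ext1 i j
    simp only [Matrix.of_apply, Matrix.submatrix_apply, h1, h2, id]
  rw [h, map_zsmul, zsmul_eq_mul]

/-- The value of `phi` on a term of the cycle. -/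
def term (σ : Equiv.Perm (Fin 7 ⊕ Fin 3)) : K := (Equiv.Perm.sign σ : ℤ) •
    phi K (wedge K 7 (fun i => e K (σ (Sum.inl i))) ⊗ₜ[K]
      jac K (e K (σ (Sum.inr 0))) (e K (σ (Sum.inr 1))) (e K (σ (Sum.inr 2))))

lemma term_sumCongr (a : Equiv.Perm (Fin 7)) (b : Equiv.Perm (Fin 3)) :
    term K (Equiv.Perm.sumCongr a b) = 27 := by
  rw [term, phi_apply]
  simp only [Equiv.Perm.sumCongr_apply, Sum.map_inl, Sum.map_inr]
  rw [jac_perm]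
  have h : (Matrix.of fun i => L K (e K (Sum.inl (a i)))) =
      (1 : Matrix (Fin 7) (Fin 7) K).submatrix a id := by
    ext i k
    simp [L_e, Matrix.one_apply]
  rw [h, Matrix.det_permute, Matrix.det_one, mul_one, Equiv.Perm.sign_sumCongr, zsmul_eq_mul]
  rcases Int.units_eq_one_or (Equiv.Perm.sign a) with h1 | h1 <;>
  rcases Int.units_eq_one_or (Equiv.Perm.sign b) with h2 | h2 <;> simp [h1, h2]

lemma term_cases (σ : Equiv.Perm (Fin 7 ⊕ Fin 3)) : term K σ = 0 ∨ term K σ = 27 := by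
  by_cases h : Set.MapsTo σ (Set.range Sum.inl) (Set.range Sum.inl)
  · obtain ⟨⟨a, b⟩, rfl⟩ := Equiv.Perm.mem_sumCongrHom_range_of_perm_mapsTo_inl h
    exact Or.inr (term_sumCongr K a b)
  · left
    have h' : ∃ i : Fin 7, ∀ k : Fin 7, σ (Sum.inl i) ≠ Sum.inl k := by
      by_contra hc
      push Not at hc
      apply h
      rintro _ ⟨i, rfl⟩
      obtain ⟨k, hk⟩ := hc i
      exact ⟨k, hk.symm⟩
    obtain ⟨i, hi⟩ := h'
    rw [term, phi_apply, Matrix.det_eq_zero_of_row_eq_zero i, zero_mul, smul_zero]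
    intro k
    rw [Matrix.of_apply, L_e, if_neg (hi k)]

lemma phi_cyc [CharZero K] : phi K (cyc K) ≠ 0 := by
  classical
  have h : phi K (cyc K) = ∑ σ : Equiv.Perm (Fin 7 ⊕ Fin 3), term K σ := by
    rw [cyc, map_sum]
    exact Finset.sum_congr rfl fun σ _ => map_zsmul _ _ _
  have h2 : ∀ σ, term K σ = ((if term K σ = 0 then 0 else 27 : ℕ) : K) := by
    intro σ
    split_ifs with h0
    · simp [h0]
    · simp [(term_cases K σ).resolve_left h0]
  rw [h, Finset.sum_congr rfl (fun σ _ => h2 σ), ← Nat.cast_sum, Nat.cast_ne_zero]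
  have h1 : term K 1 = 27 := by
    have := term_sumCongr K 1 1
    rwa [Equiv.Perm.sumCongr_one] at this
  intro h0
  rw [Finset.sum_eq_zero_iff] at h0
  have := h0 1 (Finset.mem_univ _)
  rw [h1, if_neg (by norm_num)] at this
  omega

end VKProof

end VKProof

/-- for `n = 3`, `d = 3`, there is `q ≥ 2` such that the Veronese–Koszul complex
at `(7, q)` is not exact. -/
theorem stmt13 (K : Type*) [Field K] [CharZero K] :
    ∃ q, 2 ≤ q ∧ ¬ VKExact K 3 3 7 q := by
  refine ⟨2, le_refl 2, fun hex => ?_⟩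
  obtain ⟨δ₁, h₁⟩ := VKProof.exists_isKoszulMap K 3 3 6 (2 * 3)
  obtain ⟨δ₂, h₂⟩ := VKProof.exists_isKoszulMap K 3 3 7 ((2 - 1) * 3)
  have h := hex rfl δ₁ δ₂ h₁ h₂
  have hc : VKProof.cyc K ∈ LinearMap.ker δ₁ := VKProof.cyc_mem K δ₁ h₁
  obtain ⟨y, hy⟩ := h.le hc
  apply VKProof.phi_cyc K
  rw [← hy]
  exact LinearMap.congr_fun (VKProof.phi_bdry K rfl δ₂ h₂) y
end

section
/- Suppose n ≥ 3 and d = 2. Then there exists an integer q ≥ 2 such that the Veronese–Koszul complex at (6, q) is not exact. (Equivalently, the quadratic Veronese embedding φ_{O(2)} : P^n ↪ P^N does not satisfy property N_6.) -/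
open TensorProduct

namespace VKAux

noncomputable section

open AlternatingMap

section generic

variable {K : Type*} [Field K] {V N N' : Type*} [AddCommGroup V] [Module K V]
  [AddCommGroup N] [Module K N] [AddCommGroup N'] [Module K N']

/-- `n ↦ v ↦ (w ↦ w ⊗ f v n)` precomposed with the wedge. -/
def pre (a : ℕ) (f : V →ₗ[K] N →ₗ[K] N') :
    N →ₗ[K] V →ₗ[K] V [⋀^Fin a]→ₗ[K] ((⋀[K]^a V) ⊗[K] N') :=
  LinearMap.mk₂ K
    (fun n v => ((TensorProduct.mk K (⋀[K]^a V) N').flip (f v n)).compAlternatingMap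
      (exteriorPower.ιMulti K a))
    (by intros; ext; simp [TensorProduct.tmul_add])
    (by intros; ext; simp)
    (by intros; ext; simp [TensorProduct.tmul_add])
    (by intros; ext; simp)

/-- Curried contraction. -/
def contrAux (a : ℕ) (f : V →ₗ[K] N →ₗ[K] N') :
    N →ₗ[K] (⋀[K]^(a + 1) V) →ₗ[K] (⋀[K]^a V) ⊗[K] N' where
  toFun n := exteriorPower.alternatingMapLinearEquiv (R := K) (M := V) (N := (⋀[K]^a V) ⊗[K] N')
    (alternatizeUncurryFin (R := K) (M := V) (N := (⋀[K]^a V) ⊗[K] N') (pre a f n))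
  map_add' x y := by rw [map_add, alternatizeUncurryFin_add, map_add]
  map_smul' c x := by rw [map_smul, alternatizeUncurryFin_smul, map_smul, RingHom.id_apply]

/-- Contraction with a bilinear map. -/
def contr (a : ℕ) (f : V →ₗ[K] N →ₗ[K] N') :
    (⋀[K]^(a + 1) V) ⊗[K] N →ₗ[K] (⋀[K]^a V) ⊗[K] N' :=
  TensorProduct.lift (LinearMap.flip (contrAux a f))

lemma contr_apply (a : ℕ) (f : V →ₗ[K] N →ₗ[K] N') (v : Fin (a + 1) → V) (n : N) :
    contr a f (exteriorPower.ιMulti K (a + 1) v ⊗ₜ n) =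
      ∑ j : Fin (a + 1), ((-1 : ℤ) ^ (j : ℕ)) •
        (exteriorPower.ιMulti K a (j.removeNth v) ⊗ₜ[K] f (v j) n) := by
  simp [contr, contrAux, alternatizeUncurryFin_apply, pre]

lemma tensor_ext {a : ℕ} {M : Type*} [AddCommGroup M] [Module K M]
    {A B : (⋀[K]^a V) ⊗[K] N →ₗ[K] M}
    (h : ∀ v n, A (exteriorPower.ιMulti K a v ⊗ₜ n) = B (exteriorPower.ιMulti K a v ⊗ₜ n)) :
    A = B := by
  apply TensorProduct.ext
  apply exteriorPower.linearMap_ext (R := K) (M := V) (N := N →ₗ[K] M)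
  ext v n
  exact h v n

lemma contr_cons (a : ℕ) (f : V →ₗ[K] N →ₗ[K] N') (x : V) (v : Fin (a + 1) → V) (n : N) :
    contr (a + 1) f (exteriorPower.ιMulti K (a + 2) (Fin.cons x v : Fin (a + 2) → V) ⊗ₜ n) =
      exteriorPower.ιMulti K (a + 1) v ⊗ₜ[K] f x n -
      ∑ j : Fin (a + 1), ((-1 : ℤ) ^ (j : ℕ)) •
        (exteriorPower.ιMulti K (a + 1) (Fin.cons x (j.removeNth v) : Fin (a + 1) → V)
          ⊗ₜ[K] f (v j) n) := by
  rw [contr_apply, Fin.sum_univ_succ, sub_eq_add_neg]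
  refine congrArg₂ _ ?_ (Eq.trans ?_ (Finset.sum_neg_distrib (G := (⋀[K]^(a + 1) V) ⊗[K] N') _))
  · simp
  · refine Finset.sum_congr rfl fun j _ => ?_
    rw [Fin.cons_succ, Fin.val_succ, pow_succ, mul_neg_one, neg_smul]
    congr 4
    funext i
    refine Fin.cases ?_ (fun i => ?_) i
    · simp [Fin.removeNth_apply]
    · simp [Fin.removeNth_apply]

/-- A functional killing every wedge with first factor `x`. -/
def Kills {a : ℕ} (ψ : (⋀[K]^(a + 1) V) ⊗[K] N →ₗ[K] K) (x : V) : Prop :=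
  ∀ (v : Fin a → V) (n : N),
    ψ (exteriorPower.ιMulti K (a + 1) (Fin.cons x v : Fin (a + 1) → V) ⊗ₜ n) = 0

lemma kills_eval {a : ℕ} {ψ : (⋀[K]^(a + 1) V) ⊗[K] N' →ₗ[K] K} {x : V} (h : Kills ψ x)
    (f : V →ₗ[K] N →ₗ[K] N') (v : Fin (a + 1) → V) (n : N) :
    (ψ ∘ₗ contr (a + 1) f) (exteriorPower.ιMulti K (a + 2) (Fin.cons x v : Fin (a + 2) → V) ⊗ₜ n) =
      ψ (exteriorPower.ιMulti K (a + 1) v ⊗ₜ[K] f x n) := by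
  rw [LinearMap.comp_apply, contr_cons, map_sub, map_sum, Finset.sum_eq_zero, sub_zero]
  intro j _
  rw [map_zsmul, h, smul_zero]

lemma kills_comp {a : ℕ} {ψ : (⋀[K]^(a + 1) V) ⊗[K] N' →ₗ[K] K} {x : V} (h : Kills ψ x)
    (f : V →ₗ[K] N →ₗ[K] N') (hf : f x = 0) : Kills (ψ ∘ₗ contr (a + 1) f) x := by
  intro v n
  rw [kills_eval h]
  simp [hf]

lemma contr_natural {M M' : Type*} [AddCommGroup M] [Module K M] [AddCommGroup M'] [Module K M']
    (a : ℕ) (f : V →ₗ[K] N →ₗ[K] N') (g : V →ₗ[K] M →ₗ[K] M') (i : N →ₗ[K] M) (i' : N' →ₗ[K] M')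
    (h : ∀ v n, i' (f v n) = g v (i n)) (t) :
    LinearMap.lTensor _ i' (contr a f t) = contr a g (LinearMap.lTensor _ i t) := by
  have : LinearMap.lTensor _ i' ∘ₗ contr a f = contr a g ∘ₗ LinearMap.lTensor _ i := by
    apply tensor_ext (M := (⋀[K]^a V) ⊗[K] M')
    intro v n
    simp [contr_apply, h]
  exact LinearMap.congr_fun this t

lemma contr_eq_zero (a : ℕ) (f : V →ₗ[K] N →ₗ[K] N') (v : Fin (a + 1) → V) (n : N)
    (h : ∀ j, f (v j) = 0) : contr a f (exteriorPower.ιMulti K (a + 1) v ⊗ₜ n) = 0 := by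
  simp [contr_apply, h]

end generic

section poly

variable {K : Type*} [Field K] {V P : Type*} [AddCommGroup V] [Module K V]
  [CommRing P] [Algebra K P]

/-- Contraction with a linear map to the coefficient algebra. -/
def cP (a : ℕ) (f : V →ₗ[K] P) : (⋀[K]^(a + 1) V) ⊗[K] P →ₗ[K] (⋀[K]^a V) ⊗[K] P :=
  contr a (LinearMap.mul K P ∘ₗ f)

lemma cP_apply (a : ℕ) (f : V →ₗ[K] P) (v : Fin (a + 1) → V) (n : P) :
    cP a f (exteriorPower.ιMulti K (a + 1) v ⊗ₜ n) =
      ∑ j : Fin (a + 1), ((-1 : ℤ) ^ (j : ℕ)) •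
        (exteriorPower.ιMulti K a (j.removeNth v) ⊗ₜ[K] (f (v j) * n)) := by
  simp [cP, contr_apply]

lemma cP_add (a : ℕ) (f g : V →ₗ[K] P) : cP a (f + g) = cP a f + cP a g := by
  apply tensor_ext (M := (⋀[K]^a V) ⊗[K] P)
  intro v n
  simp [cP_apply, add_mul, TensorProduct.tmul_add, Finset.sum_add_distrib]

lemma cP_sq (a : ℕ) (f : V →ₗ[K] P) : cP a f ∘ₗ cP (a + 1) f = 0 := by
  apply tensor_ext (M := (⋀[K]^a V) ⊗[K] P)
  intro v n
  let B : V →ₗ[K] V →ₗ[K] V [⋀^Fin a]→ₗ[K] ((⋀[K]^a V) ⊗[K] P) :=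
    LinearMap.mk₂ K
      (fun x y => ((TensorProduct.mk K (⋀[K]^a V) P).flip (f y * (f x * n))).compAlternatingMap
        (exteriorPower.ιMulti K a))
      (by intros; ext; simp [TensorProduct.tmul_add, add_mul, mul_add])
      (by intros; ext; simp)
      (by intros; ext; simp [TensorProduct.tmul_add, add_mul, mul_add])
      (by intros; ext; simp)
  have hB := alternatizeUncurryFin_alternatizeUncurryFinLM_comp_of_symmetric
    (N := (⋀[K]^a V) ⊗[K] P) (f := B)
    (by intro x y; ext w; simp [B, mul_left_comm])
  have := congrArg (fun F => F v) hB
  simpa [alternatizeUncurryFin_apply, B, cP_apply, map_sum] using this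

lemma cP_sq_apply (a : ℕ) (f : V →ₗ[K] P) (t) : cP a f (cP (a + 1) f t) = 0 :=
  LinearMap.congr_fun (cP_sq a f) t

lemma cP_anti (a : ℕ) (f g : V →ₗ[K] P) (t) :
    cP a f (cP (a + 1) g t) = - cP a g (cP (a + 1) f t) := by
  have h := LinearMap.congr_fun (cP_sq a (f + g)) t
  have h1 := LinearMap.congr_fun (cP_sq a f) t
  have h2 := LinearMap.congr_fun (cP_sq a g) t
  simp only [cP_add, LinearMap.comp_apply, LinearMap.add_apply, map_add, LinearMap.zero_apply]
    at h h1 h2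
  rw [h1, h2] at h
  simp only [zero_add, add_zero] at h
  exact (eq_neg_of_add_eq_zero_right (α := (⋀[K]^a V) ⊗[K] P) h)

lemma cP_zero (a : ℕ) (f g : V →ₗ[K] P) (t) (h : cP (a + 1) f t = 0) :
    cP a f (cP (a + 1) g t) = 0 := by
  rw [cP_anti, h, _root_.map_zero]
  exact neg_zero (G := (⋀[K]^a V) ⊗[K] P)

end poly

section veronese

open MvPolynomial

variable (K : Type*) [Field K] (n : ℕ)

/-- The polynomial ring. -/
abbrev P := MvPolynomial (Fin (n + 1)) K

variable {K n}

/-- Graded multiplication. -/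
def gr {d c : ℕ} (g : S K n d →ₗ[K] P K n) (hg : ∀ s, g s ∈ S K n c) (b : ℕ) :
    S K n d →ₗ[K] S K n b →ₗ[K] S K n (b + c) :=
  LinearMap.mk₂ K
    (fun s w => ⟨g s * (w : P K n), by
      have h1 := (mem_homogeneousSubmodule _ _).1 (hg s)
      have h2 := (mem_homogeneousSubmodule _ _).1 w.2
      rw [mem_homogeneousSubmodule, Nat.add_comm b c]
      exact h1.mul h2⟩)
    (by intros; ext1; simp [add_mul])
    (by intros; ext1; simp)
    (by intros; ext1; simp [mul_add])
    (by intros; ext1; simp)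

lemma gr_coe {d c : ℕ} (g : S K n d →ₗ[K] P K n) (hg : ∀ s, g s ∈ S K n c) (b : ℕ)
    (s : S K n d) (w : S K n b) : ((gr g hg b s w : S K n (b + c)) : P K n) = g s * w := rfl

/-- The contraction giving the Koszul map. -/
def kos (d a b : ℕ) :
    (⋀[K]^(a + 1) (S K n d)) ⊗[K] (S K n b) →ₗ[K] (⋀[K]^a (S K n d)) ⊗[K] (S K n (b + d)) :=
  contr a (gr (S K n d).subtype (fun s => s.2) b)

lemma skipAt_eq {a : ℕ} (j : Fin (a + 1)) (i : Fin a) :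
    skipAt j (i : Fin (a + 1 - 1)) = j.succAbove i := by
  apply Fin.ext
  simp only [skipAt, Fin.succAbove, Fin.lt_def, Fin.val_castSucc]
  split_ifs <;> rfl

lemma isKoszul (d a b : ℕ) : IsKoszulMap K n d (a + 1) b (kos d a b) := by
  intro s w
  refine (contr_apply a _ s w).trans ?_
  refine Finset.sum_congr rfl fun j _ => ?_
  have h1 : (fun i : Fin a => s (skipAt j i)) = j.removeNth s := by
    funext i
    rw [skipAt_eq]
    rfl
  have h2 : (wedge K (a + 1 - 1) fun i => s (skipAt j i)) =
      exteriorPower.ιMulti K a (j.removeNth s) := by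
    rw [← h1]
    rfl
  rw [h2]
  have h3 : mulSW K (s j) w = gr (S K n d).subtype (fun s => s.2) b (s j) w := rfl
  rw [h3]
  rcases neg_one_pow_eq_or ℤ (j : ℕ) with h | h
  · have h' : (-1 : K) ^ (j : ℕ) = 1 := by exact_mod_cast congrArg (Int.cast : ℤ → K) h
    rw [h, h', one_smul, one_smul]
  · have h' : (-1 : K) ^ (j : ℕ) = -1 := by exact_mod_cast congrArg (Int.cast : ℤ → K) h
    rw [h, h']
    exact (neg_one_smul ℤ _).trans (neg_one_smul K _).symm

/-- The partial derivative on quadrics. -/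
def pd (i : Fin (n + 1)) : S K n 2 →ₗ[K] P K n :=
  (pderiv i).toLinearMap ∘ₗ (S K n 2).subtype

lemma pd_mem (i : Fin (n + 1)) (s : S K n 2) : pd i s ∈ S K n 1 := by
  have := ((mem_homogeneousSubmodule _ _).1 s.2).pderiv (i := i)
  exact (mem_homogeneousSubmodule _ _).2 this

/-- quadratic monomials -/
def mon (i j : Fin (n + 1)) : S K n 2 :=
  ⟨X i * X j, (mem_homogeneousSubmodule _ _).2 ((isHomogeneous_X K i).mul (isHomogeneous_X K j))⟩

lemma cP_two_subtype (t) :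
    (2 : K) • cP 5 (S K n 2).subtype t =
      ∑ i, LinearMap.lTensor _ (LinearMap.mulLeft K (X i : P K n)) (cP 5 (pd i) t) := by
  have : (2 : K) • cP 5 (S K n 2).subtype =
      ∑ i, LinearMap.lTensor _ (LinearMap.mulLeft K (X i : P K n)) ∘ₗ (cP 5 (pd i)) := by
    apply tensor_ext (M := (⋀[K]^5 (S K n 2)) ⊗[K] P K n)
    intro v p
    simp only [LinearMap.smul_apply, LinearMap.sum_apply, LinearMap.comp_apply, cP_apply, map_sum,
      map_zsmul, LinearMap.lTensor_tmul, LinearMap.mulLeft_apply]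
    rw [Finset.sum_comm, Finset.smul_sum]
    refine Finset.sum_congr rfl fun j _ => ?_
    rw [← Finset.smul_sum, ← TensorProduct.tmul_sum, smul_comm, ← TensorProduct.tmul_smul]
    congr 2
    have := ((mem_homogeneousSubmodule _ _).1 (v j).2).sum_X_mul_pderiv
    simp only [← mul_assoc, ← Finset.sum_mul]
    have h2 : ∑ i, (X i : P K n) * pd i (v j) = 2 • ((v j : S K n 2) : P K n) := this
    rw [h2]
    have hC : (C 2 : P K n) = 2 := map_ofNat C 2
    rw [smul_eq_C_mul, hC, nsmul_eq_mul, mul_assoc]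
    rfl
  have := LinearMap.congr_fun this t
  simpa using this

variable (hn : 3 ≤ n)

/-- The first four indices. -/
def e (k : Fin 4) : Fin (n + 1) := Fin.castLE (by omega) k

lemma e_inj {k l : Fin 4} : e hn k = e hn l ↔ k = l := by
  simp [e, Fin.ext_iff]

/-- six squarefree monomials -/
def sqf : Fin 6 → S K n 2 :=
  ![mon (e hn 0) (e hn 1), mon (e hn 0) (e hn 2), mon (e hn 0) (e hn 3),
    mon (e hn 1) (e hn 2), mon (e hn 1) (e hn 3), mon (e hn 2) (e hn 3)]

/-- squares -/
def sq (k : Fin 4) : S K n 2 := mon (e hn k) (e hn k)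

/-- the ten quadratic monomials in the first four variables -/
def vol : Fin 10 → S K n 2 :=
  (Fin.cons (sq hn 3) (Fin.cons (sq hn 2) (Fin.cons (sq hn 1) (Fin.cons (sq hn 0) (sqf hn) :
    Fin 7 → S K n 2) : Fin 8 → S K n 2) : Fin 9 → S K n 2) : Fin 10 → S K n 2)

/-- the cycle with polynomial coefficients -/
def zP : (⋀[K]^6 (S K n 2)) ⊗[K] P K n :=
  cP 6 (pd (e hn 0)) (cP 7 (pd (e hn 1)) (cP 8 (pd (e hn 2)) (cP 9 (pd (e hn 3))
    (exteriorPower.ιMulti K 10 (vol hn) ⊗ₜ 1))))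

/-- graded unit -/
def one0 : S K n 0 := ⟨1, (mem_homogeneousSubmodule _ _).2 (isHomogeneous_one _ _)⟩

/-- graded contraction with a derivative -/
def gD (a b : ℕ) (i : Fin (n + 1)) :
    (⋀[K]^(a + 1) (S K n 2)) ⊗[K] (S K n b) →ₗ[K] (⋀[K]^a (S K n 2)) ⊗[K] (S K n (b + 1)) :=
  contr a (gr (pd i) (pd_mem i) b)

/-- the cycle -/
def zG : (⋀[K]^6 (S K n 2)) ⊗[K] (S K n 4) :=
  gD 6 3 (e hn 0) (gD 7 2 (e hn 1) (gD 8 1 (e hn 2) (gD 9 0 (e hn 3)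
    (exteriorPower.ιMulti K 10 (vol hn) ⊗ₜ one0))))

/-- inclusion to polynomial coefficients -/
abbrev inc (a b : ℕ) : (⋀[K]^a (S K n 2)) ⊗[K] (S K n b) →ₗ[K] (⋀[K]^a (S K n 2)) ⊗[K] P K n :=
  LinearMap.lTensor _ (S K n b).subtype

lemma inc_gD (a b : ℕ) (i : Fin (n + 1)) (t) :
    inc a (b + 1) (gD (K := K) a b i t) = cP a (pd i) (inc (a + 1) b t) :=
  contr_natural a _ _ _ _ (fun _ _ => rfl) t

lemma inc_kos (a b : ℕ) (t) :
    inc a (b + 2) (kos (K := K) (n := n) 2 a b t) = cP a (S K n 2).subtype (inc (a + 1) b t) :=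
  contr_natural a _ _ _ _ (fun _ _ => rfl) t

lemma inc_zG : inc 6 4 (zG (K := K) hn) = zP hn := by
  unfold zG zP
  rw [inc_gD, inc_gD, inc_gD, inc_gD]
  rfl

lemma pd_mon (i j k : Fin (n + 1)) :
    pd i (mon j k : S K n 2) = (if j = i then X k else 0) + (if k = i then X j else 0) := by
  have : pd i (mon j k : S K n 2) = pderiv i (X j * X k : P K n) := rfl
  rw [this, Derivation.leibniz, pderiv_X, pderiv_X]
  by_cases h1 : j = i <;> by_cases h2 : k = i <;>
    simp [h1, h2]

lemma pd_zP (i : Fin (n + 1)) : cP 5 (pd i) (zP (K := K) hn) = 0 := by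
  unfold zP
  by_cases h0 : i = e hn 0
  · rw [h0]
    exact cP_sq_apply 5 _ _
  refine cP_zero 5 _ _ _ ?_
  by_cases h1 : i = e hn 1
  · rw [h1]
    exact cP_sq_apply 6 _ _
  refine cP_zero 6 _ _ _ ?_
  by_cases h2 : i = e hn 2
  · rw [h2]
    exact cP_sq_apply 7 _ _
  refine cP_zero 7 _ _ _ ?_
  by_cases h3 : i = e hn 3
  · rw [h3]
    exact cP_sq_apply 8 _ _
  refine cP_zero 8 _ _ _ ?_
  have : cP 9 (pd i) (exteriorPower.ιMulti K 10 (vol hn) ⊗ₜ (1 : P K n)) = 0 := by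
    apply contr_eq_zero
    have hz : ∀ k l, pd i (mon (e hn k) (e hn l) : S K n 2) = 0 := by
      have hk : ∀ k, e hn k ≠ i := by
        intro k
        fin_cases k
        exacts [Ne.symm h0, Ne.symm h1, Ne.symm h2, Ne.symm h3]
      intro k l
      rw [pd_mon]
      simp [hk]
    intro j
    have hv : ∃ k l, vol (K := K) hn j = mon (e hn k) (e hn l) := by
      fin_cases j
      exacts [⟨3, 3, rfl⟩, ⟨2, 2, rfl⟩, ⟨1, 1, rfl⟩, ⟨0, 0, rfl⟩, ⟨0, 1, rfl⟩, ⟨0, 2, rfl⟩,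
        ⟨0, 3, rfl⟩, ⟨1, 2, rfl⟩, ⟨1, 3, rfl⟩, ⟨2, 3, rfl⟩]
    obtain ⟨k, l, hkl⟩ := hv
    rw [hkl, LinearMap.comp_apply, hz, _root_.map_zero]
  exact this

lemma kos_zG [CharZero K] : kos 2 5 4 (zG (K := K) hn) = 0 := by
  have hinj : Function.Injective (inc (K := K) (n := n) 5 6) :=
    Module.Flat.lTensor_preserves_injective_linearMap _ (Submodule.injective_subtype _)
  apply hinj
  have h := cP_two_subtype (zP (K := K) hn)
  simp only [pd_zP, _root_.map_zero, Finset.sum_const_zero] at h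
  rw [_root_.map_zero]
  refine (inc_kos 5 4 _).trans ?_
  rw [inc_zG]
  exact (smul_eq_zero.1 h).resolve_left two_ne_zero

/-- exponents of the squarefree quadratic monomials -/
def mexp : Fin 6 → (Fin (n + 1) →₀ ℕ) :=
  ![Finsupp.single (e hn 0) 1 + Finsupp.single (e hn 1) 1,
    Finsupp.single (e hn 0) 1 + Finsupp.single (e hn 2) 1,
    Finsupp.single (e hn 0) 1 + Finsupp.single (e hn 3) 1,
    Finsupp.single (e hn 1) 1 + Finsupp.single (e hn 2) 1,
    Finsupp.single (e hn 1) 1 + Finsupp.single (e hn 3) 1,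
    Finsupp.single (e hn 2) 1 + Finsupp.single (e hn 3) 1]

/-- exponent of `x0 x1 x2 x3` -/
def mtop : Fin (n + 1) →₀ ℕ :=
  Finsupp.single (e hn 0) 1 + Finsupp.single (e hn 1) 1 + Finsupp.single (e hn 2) 1 +
    Finsupp.single (e hn 3) 1

/-- coordinates -/
def cc : S K n 2 →ₗ[K] (Fin 6 → K) :=
  LinearMap.pi (fun k => lcoeff K (mexp hn k) ∘ₗ (S K n 2).subtype)

lemma cc_apply (s : S K n 2) (k) : cc hn s k = coeff (mexp hn k) (s : P K n) := rfl

lemma mon_coe (i j : Fin (n + 1)) : ((mon i j : S K n 2) : P K n) =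
    monomial (Finsupp.single i 1 + Finsupp.single j 1) 1 := by
  simp [mon, X, monomial_mul]

lemma sqf_coe (k : Fin 6) : ((sqf hn k : S K n 2) : P K n) = monomial (mexp hn k) 1 := by
  fin_cases k <;> exact mon_coe _ _

lemma mexp_inj : Function.Injective (mexp hn) := by
  intro k l h
  have h0 := DFunLike.congr_fun h (e hn 0)
  have h1 := DFunLike.congr_fun h (e hn 1)
  have h2 := DFunLike.congr_fun h (e hn 2)
  have h3 := DFunLike.congr_fun h (e hn 3)
  revert h0 h1 h2 h3
  clear h
  revert k l
  simp only [mexp, Fin.forall_fin_succ, Fin.forall_fin_zero_pi]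
  simp [Finsupp.single_apply, e_inj]

lemma cc_sqf (k : Fin 6) : cc hn (sqf hn k : S K n 2) = Pi.single k 1 := by
  funext l
  rw [cc_apply, sqf_coe, coeff_monomial, Pi.single_apply]
  simp [(mexp_inj hn).eq_iff, eq_comm]

lemma cc_sq (i : Fin 4) : cc hn (sq hn i : S K n 2) = 0 := by
  funext l
  rw [cc_apply, sq, mon_coe, coeff_monomial, if_neg]
  · rfl
  intro h
  have h0 := DFunLike.congr_fun h (e hn i)
  fin_cases l <;> fin_cases i <;> simp [mexp, Finsupp.single_apply, e_inj] at h0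

lemma exists_mexp {d : Fin (n + 1) →₀ ℕ} (hd : d ≤ mtop hn) (h2 : d.degree = 2) :
    ∃ k, d = mexp hn k := by
  have key : d = Finsupp.single (e hn 0) (d (e hn 0)) + Finsupp.single (e hn 1) (d (e hn 1)) +
      Finsupp.single (e hn 2) (d (e hn 2)) + Finsupp.single (e hn 3) (d (e hn 3)) := by
    ext i
    by_cases hi : ∃ k, i = e hn k
    · obtain ⟨k, rfl⟩ := hi
      fin_cases k <;> simp [Finsupp.single_apply, e_inj]
    · push Not at hi
      have := hd i
      simp [mtop, Finsupp.single_apply, fun k => (hi k).symm] at this ⊢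
      exact this
  have hle : ∀ k, d (e hn k) ≤ 1 := by
    intro k
    have := hd (e hn k)
    fin_cases k <;> simpa [mtop, Finsupp.single_apply, e_inj] using this
  have hsum : d (e hn 0) + d (e hn 1) + d (e hn 2) + d (e hn 3) = 2 := by
    rw [key] at h2
    simpa [Finsupp.degree_single] using h2
  have a0 := hle 0
  have a1 := hle 1
  have a2 := hle 2
  have a3 := hle 3
  generalize d (e hn 0) = b0 at *
  generalize d (e hn 1) = b1 at *
  generalize d (e hn 2) = b2 at *
  generalize d (e hn 3) = b3 at *
  subst key
  interval_cases b0 <;> interval_cases b1 <;> interval_cases b2 <;> interval_cases b3 <;>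
    simp at hsum
  · exact ⟨5, by simp [mexp]⟩
  · exact ⟨4, by simp [mexp]⟩
  · exact ⟨3, by simp [mexp]⟩
  · exact ⟨2, by simp [mexp]⟩
  · exact ⟨1, by simp [mexp]⟩
  · exact ⟨0, by simp [mexp]⟩

lemma coeff_of_cc (s : S K n 2) (hs : cc hn s = 0) (w : P K n) :
    coeff (mtop hn) ((s : P K n) * w) = 0 := by
  rw [coeff_mul]
  apply Finset.sum_eq_zero
  rintro ⟨d, d'⟩ h
  rw [Finset.HasAntidiagonal.mem_antidiagonal] at h
  simp only at h ⊢
  by_cases h2 : d.degree = 2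
  · obtain ⟨k, rfl⟩ := exists_mexp hn (d := d) (by rw [← h]; exact le_self_add) h2
    have := congrFun hs k
    rw [cc_apply] at this
    rw [this]
    simp
  · rw [((mem_homogeneousSubmodule _ _).1 s.2).coeff_eq_zero h2, zero_mul]

lemma coeff_formula (s : S K n 2) (w : P K n) :
    coeff (mtop hn) ((s : P K n) * w) =
      ∑ k, cc hn s k * coeff (mtop hn) (((sqf hn k : S K n 2) : P K n) * w) := by
  have h := coeff_of_cc hn (s - ∑ k, cc hn s k • sqf hn k) (by
    rw [map_sub, map_sum, sub_eq_zero]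
    funext l
    simp [cc_sqf, Pi.single_apply]) w
  rw [← sub_eq_zero, ← h]
  simp [sub_mul, Finset.sum_mul, coeff_sum]

/-- the functional detecting the class -/
def phi : (⋀[K]^6 (S K n 2)) ⊗[K] P K n →ₗ[K] K :=
  TensorProduct.lift ((LinearMap.mul K K).compl₁₂
    (exteriorPower.alternatingMapLinearEquiv
      ((Matrix.detRowAlternating (n := Fin 6) (R := K)).compLinearMap (cc hn)))
    (lcoeff K (mtop hn)))

lemma phi_apply (v : Fin 6 → S K n 2) (p : P K n) :
    phi hn (exteriorPower.ιMulti K 6 v ⊗ₜ p) =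
      Matrix.detRowAlternating (fun j => cc hn (v j)) * coeff (mtop hn) p := by
  simp [phi]

lemma phi_cP (t) : phi hn (cP 6 (S K n 2).subtype t) = 0 := by
  have : phi hn ∘ₗ cP 6 (S K n 2).subtype = 0 := by
    apply tensor_ext
    intro v w
    let ℓ : (Fin 6 → K) →ₗ[K] K :=
      ∑ k, (coeff (mtop hn) (((sqf hn k : S K n 2) : P K n) * w)) • LinearMap.proj k
    let F : (Fin 6 → K) →ₗ[K] (Fin 6 → K) [⋀^Fin 6]→ₗ[K] K :=
      ℓ.smulRight (Matrix.detRowAlternating (n := Fin 6) (R := K))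
    have h := (alternatizeUncurryFin F).map_linearDependent (fun j => cc hn (v j)) (by
      intro hli
      have := hli.fintype_card_le_finrank
      simp at this)
    rw [alternatizeUncurryFin_apply] at h
    rw [LinearMap.comp_apply, cP_apply, map_sum, LinearMap.zero_apply, ← h]
    refine Finset.sum_congr rfl fun j _ => ?_
    rw [map_zsmul, phi_apply, Submodule.subtype_apply, coeff_formula]
    congr 1
    simp only [F, ℓ, LinearMap.smulRight_apply, AlternatingMap.smul_apply, LinearMap.sum_apply,
      LinearMap.smul_apply, LinearMap.proj_apply, smul_eq_mul]
    rw [mul_comm]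
    exact congrArg₂ (· * ·) (Finset.sum_congr rfl fun k _ => mul_comm _ _)
      (congrArg (Matrix.detRowAlternating (n := Fin 6) (R := K)) rfl)
  exact LinearMap.congr_fun this t

lemma phi_kills (i : Fin 4) : Kills (a := 5) (phi (K := K) hn) (sq hn i) := by
  intro v p
  rw [phi_apply, AlternatingMap.map_coord_zero _ (0 : Fin 6), zero_mul]
  simp [cc_sq]

lemma pd_sq_ne {k l : Fin 4} (h : k ≠ l) : pd (e hn k) (sq hn l : S K n 2) = 0 := by
  rw [sq, pd_mon]
  simp [e_inj, h.symm]

lemma pd_sq (k : Fin 4) : pd (e hn k) (sq hn k : S K n 2) = 2 * X (e hn k) := by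
  rw [sq, pd_mon]
  simp [two_mul]

lemma detRow_one {ι : Type*} [Fintype ι] [DecidableEq ι] (M : ι → ι → K)
    (h : ∀ j k, M j k = if j = k then 1 else 0) : Matrix.detRowAlternating M = (1 : K) := by
  have hM : Matrix.of M = 1 := by
    ext j k
    rw [Matrix.of_apply, h, Matrix.one_apply]
  have h1 : Matrix.det (Matrix.of M) = 1 := by rw [hM, Matrix.det_one]
  exact h1

lemma phi_zP : phi hn (zP (K := K) hn) = 16 := by
  have k0 := fun i => phi_kills (K := K) hn i
  have hz : ∀ k l : Fin 4, k ≠ l → (LinearMap.mul K (P K n) ∘ₗ pd (e hn k)) (sq hn l) = 0 := by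
    intro k l h
    rw [LinearMap.comp_apply, pd_sq_ne hn h, _root_.map_zero]
  have k1 := fun i (h : (0 : Fin 4) ≠ i) => kills_comp (k0 i) _ (hz 0 i h)
  have k2 := fun i (h : (0 : Fin 4) ≠ i) (h' : (1 : Fin 4) ≠ i) =>
    kills_comp (k1 i h) _ (hz 1 i h')
  have k3 := fun i (h : (0 : Fin 4) ≠ i) (h' : (1 : Fin 4) ≠ i) (h'' : (2 : Fin 4) ≠ i) =>
    kills_comp (k2 i h h') _ (hz 2 i h'')
  have e3 := fun v p => kills_eval (k3 3 (by decide) (by decide) (by decide))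
    (LinearMap.mul K (P K n) ∘ₗ pd (e hn 3)) v p
  have e2 := fun v p => kills_eval (k2 2 (by decide) (by decide))
    (LinearMap.mul K (P K n) ∘ₗ pd (e hn 2)) v p
  have e1 := fun v p => kills_eval (k1 1 (by decide))
    (LinearMap.mul K (P K n) ∘ₗ pd (e hn 1)) v p
  have e0 := fun v p => kills_eval (k0 0)
    (LinearMap.mul K (P K n) ∘ₗ pd (e hn 0)) v p
  refine (e3 _ _).trans ((e2 _ _).trans ((e1 _ _).trans ((e0 (sqf hn) _).trans ?_)))
  rw [phi_apply]
  simp only [LinearMap.comp_apply, LinearMap.mul_apply', pd_sq]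
  have hd : Matrix.detRowAlternating (fun j => cc hn (sqf hn j : S K n 2)) = (1 : K) := by
    apply detRow_one
    intro j k
    rw [cc_sqf, Pi.single_apply]
    simp [eq_comm]
  rw [hd, one_mul]
  have hp : (2 * X (e hn 0) * (2 * X (e hn 1) * (2 * X (e hn 2) * (2 * X (e hn 3) * 1))) : P K n)
      = monomial (mtop hn) 16 := by
    have : (monomial (mtop hn) 16 : P K n) =
        C 16 * (X (e hn 0) * X (e hn 1) * X (e hn 2) * X (e hn 3)) := by
      simp [mtop, X, monomial_mul, C_mul_monomial]
    rw [this]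
    have h16 : (C 16 : P K n) = 16 := map_ofNat C 16
    rw [h16]
    ring
  rw [hp, coeff_monomial, if_pos rfl]

end veronese

end

end VKAux

/-- for `n ≥ 3`, `d = 2`, there is `q ≥ 2` such that the Veronese–Koszul complex
at `(6, q)` is not exact (failure of `N_6` for the quadratic Veronese embedding). -/
theorem stmt15 (K : Type*) [Field K] [CharZero K] (n : ℕ) (hn : 3 ≤ n) :
    ∃ q, 2 ≤ q ∧ ¬ VKExact K n 2 6 q := by
  refine ⟨2, le_refl _, fun hE => ?_⟩
  have h := hE rfl (VKAux.kos 2 5 4) (VKAux.kos 2 6 2) (VKAux.isKoszul 2 5 4)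
    (VKAux.isKoszul 2 6 2)
  have hz : VKAux.zG (K := K) hn ∈ LinearMap.ker (VKAux.kos (K := K) (n := n) 2 5 4) :=
    LinearMap.mem_ker.2 (VKAux.kos_zG hn)
  have hz' := h.le hz
  obtain ⟨y, hy⟩ := hz'
  have hy2 : VKAux.kos 2 6 2 y = VKAux.zG (K := K) hn := by
    rw [← hy]
    have : (TensorProduct.congr (LinearEquiv.refl K (⋀[K]^6 (S K n 2)))
            (scast K (n := n) (e₁ := 4) (e₂ := 4) rfl)) = LinearEquiv.refl K _ := by
      apply LinearEquiv.toLinearMap_injective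
      apply TensorProduct.ext'
      intro x y
      rfl
    exact (LinearEquiv.congr_fun this _).symm
  have h16 := VKAux.phi_zP (K := K) hn
  rw [← VKAux.inc_zG, ← hy2] at h16
  have hk := VKAux.inc_kos 6 2 y
  have h0 := VKAux.phi_cP hn (VKAux.inc 7 2 y)
  rw [← hk] at h0
  have : (16 : K) = 0 := h16.symm.trans h0
  norm_num at this
end
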